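/- arXiv:1108.2925 — 6 statements merged into one kernel-verified Lean document; each statement's English description precedes it below -/
import Mathlib

section
/- Let d ≥ 2 and let A = (a_{ij}) be a real d×n matrix. Then the Hessian determinant of f = ∏_{j=1}^n ℓ_j satisfies the polynomial identity det( (∂²f/∂z_i∂z_j)_{1≤i,j≤d} ) = (−1)^{d−1}·(n−1)·f^{d−2}·Σ_{I⊆{1,…,n}, |I|=d} det(A_I)²·∏_{k∉I} ℓ_k² in ℝ[z_1,…,z_d]. -/
open MvPolynomial

/-- The expansion of the determinant of a product along all choices of columns of the left
factor. -/
theorem Matrix.det_mul_eq_sum_submatrix {R m n : Type*} [CommRing R] [Fintype m] [DecidableEq m]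
    [Fintype n] (M : Matrix m n R) (N : Matrix n m R) :
    (M * N).det = ∑ p : m → n, (M.submatrix id p).det * ∏ i, N (p i) i := by
  classical
  simp only [Matrix.det_apply', Matrix.mul_apply, Finset.prod_univ_sum, Finset.mul_sum,
    Fintype.piFinset_univ, Finset.sum_mul]
  rw [Finset.sum_comm]
  refine Finset.sum_congr rfl fun p _ => Finset.sum_congr rfl fun σ _ => ?_
  simp [Finset.prod_mul_distrib, mul_assoc]

/-- A function out of `Fin d` is injective exactly when it lists some `d`-element subset in some
order, and the subset and the order are unique. -/
theorem Fin.sum_injective_eq_sum_orderEmbOfFin {R α : Type*} [AddCommMonoid R] [Fintype α]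
    [LinearOrder α] (d : ℕ) (F : (Fin d → α) → R) :
    ∑ p : Fin d → α with Function.Injective p, F p =
      ∑ I : {s : Finset α // s.card = d}, ∑ τ : Equiv.Perm (Fin d),
        F fun i => I.1.orderEmbOfFin I.2 (τ i) := by
  rw [← Fintype.sum_prod_type']
  symm
  refine Finset.sum_bij (fun x _ i => x.1.1.orderEmbOfFin x.1.2 (x.2 i)) ?_ ?_ ?_ fun _ _ => rfl
  · rintro ⟨I, τ⟩ -
    exact Finset.mem_filter.2
      ⟨Finset.mem_univ _, (I.1.orderEmbOfFin I.2).injective.comp τ.injective⟩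
  · rintro ⟨⟨I, hI⟩, τ⟩ - ⟨⟨J, hJ⟩, σ⟩ - h
    have hrange : ∀ (K : Finset α) (hK : K.card = d) (ρ : Equiv.Perm (Fin d)),
        Set.range (fun i => K.orderEmbOfFin hK (ρ i)) = K := fun K hK ρ => by
      rw [← Finset.range_orderEmbOfFin K hK]
      exact ρ.surjective.range_comp (K.orderEmbOfFin hK)
    have hIJ : I = J := by
      rw [← Finset.coe_inj, ← hrange I hI τ, ← hrange J hJ σ]
      exact congrArg Set.range h
    subst hIJ
    have hτσ : τ = σ := Equiv.ext fun i =>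
      (I.orderEmbOfFin hI).injective (congrFun h i)
    rw [hτσ]
  · intro p hp
    have hp : Function.Injective p := by simpa using hp
    have hI : (Finset.univ.image p).card = d := by
      rw [Finset.card_image_of_injective _ hp, Finset.card_fin]
    let e := (Finset.univ.image p).orderIsoOfFin hI
    let t : Fin d → Fin d := fun i =>
      e.symm ⟨p i, Finset.mem_image_of_mem p (Finset.mem_univ i)⟩
    have ht : Function.Injective t := fun i j h => hp (by
      simpa [t] using h)
    refine ⟨⟨⟨_, hI⟩, Equiv.ofBijective t (Finite.injective_iff_bijective.1 ht)⟩,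
      Finset.mem_univ _, funext fun i => ?_⟩
    change ((e (t i) : _) : α) = p i
    simp [t]

/-- The **Cauchy–Binet formula**. -/
theorem Matrix.det_mul_eq_sum_det_submatrix_mul {R α : Type*} [CommRing R] [Fintype α]
    [LinearOrder α] {d : ℕ} (M : Matrix (Fin d) α R) (N : Matrix α (Fin d) R) :
    (M * N).det = ∑ I : {s : Finset α // s.card = d},
      (M.submatrix id (I.1.orderEmbOfFin I.2)).det *
        (N.submatrix (I.1.orderEmbOfFin I.2) id).det := by
  rw [Matrix.det_mul_eq_sum_submatrix,
    ← Finset.sum_subset (Finset.filter_subset Function.Injective Finset.univ),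
    Fin.sum_injective_eq_sum_orderEmbOfFin]
  · refine Finset.sum_congr rfl fun I _ => ?_
    rw [Matrix.det_apply' (N.submatrix _ _), Finset.mul_sum]
    refine Finset.sum_congr rfl fun τ _ => ?_
    have h : (M.submatrix id fun i => I.1.orderEmbOfFin I.2 (τ i)).det =
        Equiv.Perm.sign τ * (M.submatrix id (I.1.orderEmbOfFin I.2)).det :=
      Matrix.det_permute' τ (M.submatrix id (I.1.orderEmbOfFin I.2))
    simp only [h, id, Matrix.submatrix_apply]
    ring
  · intro p _ hp
    simp only [Finset.mem_filter, Finset.mem_univ, true_and, Function.Injective, not_forall] at hp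
    obtain ⟨i, j, hpij, hij⟩ := hp
    rw [Matrix.det_zero_of_column_eq hij fun k => by simp [hpij], zero_mul]

/-- The determinant of `u uᵀ - M` for a vector `u = M z` in the image of `M`. -/
theorem Matrix.det_vecMulVec_sub {R m : Type*} [CommRing R] [Fintype m] [DecidableEq m]
    (M : Matrix m m R) (z : m → R) :
    (Matrix.vecMulVec (M.mulVec z) (M.mulVec z) - M).det =
      (-1) ^ Fintype.card m * (1 - M.mulVec z ⬝ᵥ z) * M.det := by
  have h : Matrix.vecMulVec (M.mulVec z) (M.mulVec z) - M =
      -(M * (1 - Matrix.vecMulVec z (M.mulVec z))) := by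
    rw [mul_sub, Matrix.mul_vecMulVec, mul_one, neg_sub]
  have h1 : (1 - Matrix.vecMulVec z (M.mulVec z)).det = 1 - M.mulVec z ⬝ᵥ z := by
    rw [Matrix.vecMulVec_eq Unit, Matrix.det_one_sub_mul_comm]
    simp [Matrix.replicateRow_mul_replicateCol_apply]
  rw [h, Matrix.det_neg, Matrix.det_mul, h1]
  ring

/-- The logarithmic derivative of a product of polynomials with constant partial derivatives. -/
theorem MvPolynomial.map_pderiv_prod {σ κ K R : Type*} [CommRing R] [Field K]
    [DecidableEq κ] (φ : MvPolynomial σ R →+* K)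
    (A : Matrix σ κ R) (ℓ : κ → MvPolynomial σ R)
    (hℓ : ∀ i k, pderiv i (ℓ k) = C (A i k)) (hφ : ∀ k, φ (ℓ k) ≠ 0) (s : Finset κ) (j : σ) :
    φ (pderiv j (∏ k ∈ s, ℓ k)) = φ (∏ k ∈ s, ℓ k) * ∑ k ∈ s, φ (C (A j k)) / φ (ℓ k) := by
  induction s using Finset.induction_on with
  | empty => simp
  | insert a s ha ih =>
    rw [Finset.prod_insert ha, Finset.sum_insert ha, Derivation.leibniz]
    simp only [smul_eq_mul, map_add, map_mul, ih, hℓ]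
    field_simp [hφ a]
    ring

/-- The second derivatives of a product of polynomials with constant partial derivatives, in terms
of the logarithmic derivatives of the factors. -/
theorem MvPolynomial.map_pderiv_pderiv_prod {σ κ K R : Type*} [CommRing R] [Field K]
    [DecidableEq κ] (φ : MvPolynomial σ R →+* K)
    (A : Matrix σ κ R) (ℓ : κ → MvPolynomial σ R)
    (hℓ : ∀ i k, pderiv i (ℓ k) = C (A i k)) (hφ : ∀ k, φ (ℓ k) ≠ 0) (s : Finset κ) (i j : σ) :
    φ (pderiv i (pderiv j (∏ k ∈ s, ℓ k))) = φ (∏ k ∈ s, ℓ k) *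
      ((∑ k ∈ s, φ (C (A i k)) / φ (ℓ k)) * (∑ k ∈ s, φ (C (A j k)) / φ (ℓ k)) -
        ∑ k ∈ s, φ (C (A i k)) / φ (ℓ k) * (φ (C (A j k)) / φ (ℓ k))) := by
  induction s using Finset.induction_on with
  | empty => simp
  | insert a s ha ih =>
    have h1 := MvPolynomial.map_pderiv_prod φ A ℓ hℓ hφ s
    simp only [Finset.prod_insert ha, Finset.sum_insert ha, Derivation.leibniz, map_add,
      smul_eq_mul, hℓ, pderiv_C, map_mul, ih, h1, mul_zero, zero_add]
    have := hφ a
    field_simp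
    ring

theorem MvPolynomial.pderiv_sum_C_mul_X {σ R : Type*} [CommRing R] [Fintype σ]
    (a : σ → R) (i : σ) : pderiv i (∑ j, C (a j) * X j) = C (a i) := by
  classical
  simp [pderiv_X, Pi.single_apply]

/-- The Hessian determinant formula with all quantities evaluated in a field, where `z` is the
point of evaluation, and `l k`, the value at `z` of the linear form given by the `k`-th column of
`a`, is nonzero. -/
theorem det_hessian_prod_linear_forms_of_ne_zero {K : Type*} [Field K] {d n : ℕ} (hd : 2 ≤ d)
    (a : Matrix (Fin d) (Fin n) K)
    (z : Fin d → K) (l : Fin n → K) (hz : ∀ k, ∑ i, a i k * z i = l k) (hl : ∀ k, l k ≠ 0) :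
    (Matrix.of fun i j : Fin d => (∏ k, l k) *
      ((∑ k, a i k / l k) * (∑ k, a j k / l k) - ∑ k, a i k / l k * (a j k / l k))).det =
    (-1) ^ (d - 1) * (n - 1) * (∏ k, l k) ^ (d - 2) *
      ∑ I : {s : Finset (Fin n) // s.card = d},
        (a.submatrix id (I.1.orderEmbOfFin I.2)).det ^ 2 * ∏ k ∈ I.1ᶜ, l k ^ 2 := by
  set B : Matrix (Fin d) (Fin n) K := Matrix.of fun i k => a i k / l k with hB
  have hBz : B.transpose.mulVec z = 1 := by
    funext k
    simp only [Matrix.mulVec, dotProduct, Matrix.transpose_apply, hB, Matrix.of_apply,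
      div_mul_eq_mul_div, Pi.one_apply]
    rw [← Finset.sum_div, hz, div_self (hl k)]
  have hMz : (B * B.transpose).mulVec z = B.mulVec 1 := by
    rw [← Matrix.mulVec_mulVec, hBz]
  have hdot : (B * B.transpose).mulVec z ⬝ᵥ z = n := by
    rw [hMz, dotProduct_comm, Matrix.dotProduct_mulVec, ← Matrix.mulVec_transpose, hBz]
    simp
  have hmat : (Matrix.of fun i j : Fin d => (∏ k, l k) *
      ((∑ k, a i k / l k) * (∑ k, a j k / l k) - ∑ k, a i k / l k * (a j k / l k))) =
      (∏ k, l k) • (Matrix.vecMulVec ((B * B.transpose).mulVec z) ((B * B.transpose).mulVec z)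
        - B * B.transpose) := by
    rw [hMz]
    ext i j
    simp [hB, Matrix.vecMulVec_apply, Matrix.mulVec, dotProduct, Matrix.mul_apply]
  have hdet (I : {s : Finset (Fin n) // s.card = d}) :
      (∏ k, l k) ^ 2 * ((B.submatrix id (I.1.orderEmbOfFin I.2)).det *
        (B.transpose.submatrix (I.1.orderEmbOfFin I.2) id).det) =
      (a.submatrix id (I.1.orderEmbOfFin I.2)).det ^ 2 * ∏ k ∈ I.1ᶜ, l k ^ 2 := by
    have h1 : (B.transpose.submatrix (I.1.orderEmbOfFin I.2) id).det =
        (B.submatrix id (I.1.orderEmbOfFin I.2)).det := by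
      rw [← Matrix.det_transpose, Matrix.transpose_submatrix, Matrix.transpose_transpose]
    have h2 : (∏ k ∈ I.1, l k) * (B.submatrix id (I.1.orderEmbOfFin I.2)).det =
        (a.submatrix id (I.1.orderEmbOfFin I.2)).det := by
      have h3 : ∏ k ∈ I.1, l k = ∏ i, l (I.1.orderEmbOfFin I.2 i) := by
        conv_lhs => rw [← Finset.map_orderEmbOfFin_univ I.1 I.2, Finset.prod_map]
        rfl
      rw [h3, ← Matrix.det_mul_row]
      congr 1
      ext i k
      simp [hB, mul_div_cancel₀, hl]
    rw [h1, ← Finset.prod_mul_prod_compl I.1 l, ← h2, Finset.prod_pow]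
    ring
  obtain ⟨e, rfl⟩ := Nat.exists_eq_add_of_le' hd
  rw [hmat, Matrix.det_smul, Matrix.det_vecMulVec_sub, hdot, Matrix.det_mul_eq_sum_det_submatrix_mul,
    ← Finset.sum_congr rfl fun I _ => hdet I, ← Finset.mul_sum, Fintype.card_fin]
  simp only [Nat.add_sub_cancel, show e + 2 - 1 = e + 1 by omega]
  ring


/-- The Hessian determinant of a product of linear forms `f = ∏ ℓⱼ` equals
`(−1)^(d−1)·(n−1)·f^(d−2)·Σ_{|I|=d} det(A_I)²·∏_{k∉I} ℓₖ²`. -/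
theorem stmt_0 (d n : ℕ) (hd : 2 ≤ d) (A : Matrix (Fin d) (Fin n) ℝ) :
    Matrix.det (Matrix.of fun i j : Fin d =>
        pderiv i (pderiv j (∏ k : Fin n, ∑ i' : Fin d, C (A i' k) * X i'))) =
      C ((-1 : ℝ) ^ (d - 1) * ((n : ℝ) - 1)) *
        (∏ k : Fin n, ∑ i' : Fin d, C (A i' k) * X i') ^ (d - 2) *
        ∑ I : {s : Finset (Fin n) // s.card = d},
          C ((A.submatrix id fun k : Fin d => ((I.1.orderIsoOfFin I.2 k : Fin n))).det ^ 2) *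
            ∏ k ∈ I.1ᶜ, (∑ i' : Fin d, C (A i' k) * X i') ^ 2 := by
  classical
  set ℓ : Fin n → MvPolynomial (Fin d) ℝ := fun k => ∑ i' : Fin d, C (A i' k) * X i' with hℓ
  have hderiv (i : Fin d) (k : Fin n) : pderiv i (ℓ k) = C (A i k) :=
    MvPolynomial.pderiv_sum_C_mul_X (fun i => A i k) i
  by_cases h0 : ∃ k, ℓ k = 0
  · obtain ⟨k, hk⟩ := h0
    have hA (i : Fin d) : A i k = 0 := by
      simpa [hk] using (hderiv i k).symm
    have : Nonempty (Fin d) := ⟨⟨0, by omega⟩⟩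
    have hf : ∏ k, ℓ k = 0 := Finset.prod_eq_zero (Finset.mem_univ k) hk
    have hsum : ∀ I : {s : Finset (Fin n) // s.card = d},
        C ((A.submatrix id fun k : Fin d => ((I.1.orderIsoOfFin I.2 k : Fin n))).det ^ 2) *
          ∏ k ∈ I.1ᶜ, ℓ k ^ 2 = 0 := by
      intro I
      by_cases hkI : k ∈ I.1
      · obtain ⟨j, hj⟩ := (I.1.orderIsoOfFin I.2).surjective ⟨k, hkI⟩
        rw [Matrix.det_eq_zero_of_column_eq_zero j fun i => by
          change A i (I.1.orderIsoOfFin I.2 j : Fin n) = 0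
          rw [hj]
          exact hA i]
        simp
      · rw [Finset.prod_eq_zero (Finset.mem_compl.2 hkI) (by simp [hk]), mul_zero]
    rw [Finset.sum_eq_zero fun I _ => hsum I, hf, mul_zero]
    simp only [map_zero]
    exact Matrix.det_zero
  · push Not at h0
    let φ := algebraMap (MvPolynomial (Fin d) ℝ) (FractionRing (MvPolynomial (Fin d) ℝ))
    have hφ : Function.Injective φ := IsFractionRing.injective _ _
    have hne (k : Fin n) : φ (ℓ k) ≠ 0 := (map_ne_zero_iff φ hφ).2 (h0 k)
    apply hφ
    have key := det_hessian_prod_linear_forms_of_ne_zero hd (Matrix.of fun i k => φ (C (A i k)))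
      (fun i => φ (X i)) (fun k => φ (ℓ k)) (fun k => by simp [hℓ]) hne
    rw [RingHom.map_det]
    convert key using 1
    · congr 1
      ext i j
      have := MvPolynomial.map_pderiv_pderiv_prod φ A ℓ hderiv hne Finset.univ i j
      simpa using this
    · have hdet (I : {s : Finset (Fin n) // s.card = d}) :
          φ (C (A.submatrix id fun k : Fin d => ((I.1.orderIsoOfFin I.2 k : Fin n))).det) =
          ((Matrix.of fun i k => φ (C (A i k))).submatrix id (I.1.orderEmbOfFin I.2)).det := by
        rw [RingHom.map_det, RingHom.map_det]
        rfl
      change φ (_ * (∏ k, ℓ k) ^ (d - 2) * ∑ I : {s : Finset (Fin n) // s.card = d},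
        C (_ ^ 2) * ∏ k ∈ I.1ᶜ, ℓ k ^ 2) = _
      simp only [map_mul φ, map_mul C, map_pow, map_sum φ _ Finset.univ, map_prod, hdet, map_sub,
        map_neg, map_one, map_natCast]
end

section
/- Let d ≥ 2 and let A be a real d×n matrix of rank d with no zero columns whose columns span at least d+1 distinct lines through the origin in ℝ^d (i.e., A is not basic). Then there exists a point z ∈ ℂ^d with det Hess f (z) = 0 and f(z) ≠ 0; that is, the complex hypersurface defined by the Hessian determinant of f is not contained in the hyperplane arrangement {f = 0}. -/
open MvPolynomial

/-- The bordered matrix `[[diag D, b], [-bᵀ, 0]]`. -/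
def borderedMatrix {ι R : Type*} [DecidableEq ι] [CommRing R] {d : ℕ} (D : ι → R)
    (b : Matrix ι (Fin d) R) : Matrix (ι ⊕ Fin d) (ι ⊕ Fin d) R :=
  Matrix.fromBlocks (Matrix.diagonal D) b (-b.transpose) 0

lemma det_borderedMatrix_scale {ι R : Type*} [Fintype ι] [DecidableEq ι] [CommRing R] {d : ℕ}
    (D : ι → R) (b : Matrix ι (Fin d) R) (c : R) :
    c ^ (2 * d) * (borderedMatrix (fun L => c ^ 2 * D L) b).det =
      c ^ (2 * Fintype.card ι) * (borderedMatrix D b).det := by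
  have h : Matrix.fromBlocks (1 : Matrix ι ι R) 0 0 (c • (1 : Matrix (Fin d) (Fin d) R)) *
      borderedMatrix (fun L => c ^ 2 * D L) b * Matrix.fromBlocks 1 0 0 (c • 1) =
      Matrix.fromBlocks (c • (1 : Matrix ι ι R)) 0 0 (1 : Matrix (Fin d) (Fin d) R) *
      borderedMatrix D b * Matrix.fromBlocks (c • 1) 0 0 1 := by
    have hD : Matrix.diagonal (fun L => c ^ 2 * D L) = c • c • Matrix.diagonal D := by
      ext i j
      by_cases hij : i = j
      · simp [Matrix.diagonal, hij]
        ring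
      · simp [Matrix.diagonal, hij]
    simp [borderedMatrix, Matrix.fromBlocks_multiply, hD]
  have h' := congrArg Matrix.det h
  simp only [Matrix.det_mul, Matrix.det_fromBlocks_zero₂₁, Matrix.det_smul, Matrix.det_one,
    Fintype.card_fin] at h'
  linear_combination h'

lemma map_det_borderedMatrix {ι R S : Type*} [Fintype ι] [DecidableEq ι] [CommRing R] [CommRing S]
    {d : ℕ} (φ : R →+* S) (D : ι → R) (b : Matrix ι (Fin d) R) :
    φ (borderedMatrix D b).det = (borderedMatrix (fun L => φ (D L)) (b.map φ)).det := by
  rw [RingHom.map_det]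
  congr 1
  ext (i | i) (j | j) <;> simp [borderedMatrix, Matrix.diagonal, apply_ite φ]

lemma exists_of_det_borderedMatrix_eq_zero {ι K : Type*} [Fintype ι] [DecidableEq ι] [Field K]
    {d : ℕ} {D : ι → K} {b : Matrix ι (Fin d) K} (h : (borderedMatrix D b).det = 0) :
    ∃ (x : ι → K) (y : Fin d → K), (x ≠ 0 ∨ y ≠ 0) ∧
      (∀ L, D L * x L + ∑ i, b L i * y i = 0) ∧ ∀ i, ∑ L, b L i * x L = 0 := by
  obtain ⟨u, hu, hmul⟩ := Matrix.exists_mulVec_eq_zero_iff.mpr h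
  refine ⟨u ∘ Sum.inl, u ∘ Sum.inr, ?_, fun L => ?_, fun i => ?_⟩
  · by_contra! hxy
    exact hu (funext fun k => Sum.casesOn k (congrFun hxy.1) (congrFun hxy.2))
  · have := congrFun hmul (Sum.inl L)
    simpa [borderedMatrix, Matrix.mulVec, dotProduct, Matrix.diagonal] using this
  · have := congrFun hmul (Sum.inr i)
    simpa [borderedMatrix, Matrix.mulVec, dotProduct] using this

lemma det_borderedMatrix_ne_zero {ι : Type*} [Fintype ι] [DecidableEq ι] {d : ℕ}
    {D : ι → ℝ} {b : Matrix ι (Fin d) ℝ} (hD : ∀ L, 0 ≤ D L) (L₀ : ι)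
    (hpos : ∀ L, L ≠ L₀ → 0 < D L) (hb : b L₀ ≠ 0)
    (hspan : ∀ y : Fin d → ℝ, (∀ L, ∑ i, b L i * y i = 0) → y = 0) :
    (borderedMatrix D b).det ≠ 0 := by
  intro h
  obtain ⟨x, y, hxy, h₁, h₂⟩ := exists_of_det_borderedMatrix_eq_zero h
  have hsum : ∑ L, D L * x L ^ 2 = 0 := by
    calc ∑ L, D L * x L ^ 2 = ∑ L, -(∑ i, b L i * y i) * x L :=
          Finset.sum_congr rfl fun L _ => by linear_combination x L * h₁ L
      _ = -∑ i, y i * ∑ L, b L i * x L := by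
          simp only [Finset.mul_sum, neg_mul, Finset.sum_mul, Finset.sum_neg_distrib]
          rw [Finset.sum_comm]
          exact congrArg _ (Finset.sum_congr rfl fun i _ =>
            Finset.sum_congr rfl fun L _ => by ring)
      _ = 0 := by simp [h₂]
  have hzero := (Finset.sum_eq_zero_iff_of_nonneg
    fun L _ => mul_nonneg (hD L) (sq_nonneg (x L))).mp hsum
  have hx' : ∀ L, L ≠ L₀ → x L = 0 := fun L hL => by
    have := hzero L (Finset.mem_univ _)
    simpa [(hpos L hL).ne'] using this
  have hx₀ : x L₀ = 0 := by
    by_contra hne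
    refine hb (funext fun i => ?_)
    have := h₂ i
    rw [Finset.sum_eq_single L₀ (fun L _ hL => by simp [hx' L hL]) (by simp)] at this
    simpa [hne] using this
  have hx : x = 0 := funext fun L => by
    by_cases hL : L = L₀
    · simpa [hL] using hx₀
    · exact hx' L hL
  refine hxy.elim (fun h => h hx) fun h => h (hspan y fun L => ?_)
  simpa [hx] using h₁ L

lemma exists_root_det_borderedMatrix {ι : Type*} [Fintype ι] [DecidableEq ι] {d : ℕ}
    {b : Matrix ι (Fin d) ℝ} {w α β : ι → ℝ} (hcard : d < Fintype.card ι) (hw : ∀ L, 0 < w L)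
    (hb : ∀ L, b L ≠ 0) (hspan : ∀ y : Fin d → ℝ, (∀ L, ∑ i, b L i * y i = 0) → y = 0)
    (hβ : ∀ L, β L ≠ 0) (hαβ : ∀ L L', L ≠ L' → α L * β L' ≠ α L' * β L) :
    ∃ t : ℂ, (borderedMatrix (fun L => (w L : ℂ) * (α L + t * β L) ^ 2)
      (b.map (Complex.ofRealHom : ℝ →+* ℂ))).det = 0 ∧ ∀ L, (α L + t * β L : ℂ) ≠ 0 := by
  set B : Matrix ι (Fin d) ℂ := b.map (Complex.ofRealHom : ℝ →+* ℂ) with hB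
  have hBC : ∀ r : ℂ, (B.map (Polynomial.C : ℂ →+* _)).map (Polynomial.evalRingHom r) = B := by
    intro r
    ext
    simp
  let q : Polynomial ℂ := (borderedMatrix (fun L => Polynomial.C (w L : ℂ) *
    (Polynomial.C (α L : ℂ) + Polynomial.X * Polynomial.C (β L : ℂ)) ^ 2) (B.map Polynomial.C)).det
  let r : Polynomial ℂ := (borderedMatrix (fun L => Polynomial.C (w L : ℂ) *
    (Polynomial.X * Polynomial.C (α L : ℂ) + Polynomial.C (β L : ℂ)) ^ 2) (B.map Polynomial.C)).det
  have hq : ∀ t, q.eval t = (borderedMatrix (fun L => (w L : ℂ) * (α L + t * β L) ^ 2) B).det := by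
    intro t
    rw [← Polynomial.coe_evalRingHom, map_det_borderedMatrix, hBC]
    simp [mul_comm t]
  have hr : ∀ t, r.eval t = (borderedMatrix (fun L => (w L : ℂ) * (t * α L + β L) ^ 2) B).det := by
    intro t
    rw [← Polynomial.coe_evalRingHom, map_det_borderedMatrix, hBC]
    simp [mul_comm t]
  obtain ⟨L₁⟩ : Nonempty ι := Fintype.card_pos_iff.mp (by omega)
  have hr₀ : r.eval 0 ≠ 0 := by
    have h := det_borderedMatrix_ne_zero (D := fun L => w L * β L ^ 2) (b := b)
      (fun L => mul_nonneg (hw L).le (sq_nonneg _)) L₁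
      (fun L _ => mul_pos (hw L) (by have := hβ L; positivity)) (hb L₁) hspan
    rw [← Complex.ofReal_ne_zero, ← Complex.ofRealHom_eq_coe, map_det_borderedMatrix] at h
    simpa [hr] using h
  have hdeg : q.degree ≠ 0 := by
    intro hdeg
    obtain ⟨c, hc⟩ : ∃ c, q = Polynomial.C c := ⟨_, Polynomial.eq_C_of_degree_eq_zero hdeg⟩
    have key : Polynomial.X ^ (2 * d + 1) * r =
        Polynomial.X ^ (2 * d + 1) * (Polynomial.X ^ (2 * (Fintype.card ι - d)) * Polynomial.C c) := by
      refine Polynomial.funext fun s => ?_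
      by_cases hs : s = 0
      · simp [hs]
      have h := det_borderedMatrix_scale (fun L => (w L : ℂ) * (α L + s⁻¹ * β L) ^ 2) B s
      rw [← hq, hc, Polynomial.eval_C] at h
      have h' : (fun L => s ^ 2 * ((w L : ℂ) * (α L + s⁻¹ * β L) ^ 2)) =
          fun L => (w L : ℂ) * (s * α L + β L) ^ 2 := by
        funext L
        field_simp
      rw [h', ← hr] at h
      have hexp : 2 * Fintype.card ι = 2 * d + 2 * (Fintype.card ι - d) := by omega
      rw [hexp, pow_add] at h
      simp only [Polynomial.eval_mul, Polynomial.eval_pow, Polynomial.eval_X, Polynomial.eval_C]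
      linear_combination s * h
    have key' := mul_left_cancel₀ (pow_ne_zero _ Polynomial.X_ne_zero) key
    refine hr₀ ?_
    have hpos : 2 * (Fintype.card ι - d) ≠ 0 := by omega
    simp [key', zero_pow hpos]
  obtain ⟨t, ht⟩ := IsAlgClosed.exists_root q hdeg
  refine ⟨t, (hq t).symm.trans ht, fun L₀ h₀ => ?_⟩
  have hβ' : ((β L₀ : ℝ) : ℂ) ≠ 0 := Complex.ofReal_ne_zero.mpr (hβ L₀)
  have htr : t = ((-α L₀ / β L₀ : ℝ) : ℂ) := by
    push_cast
    field_simp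
    linear_combination h₀
  have h := det_borderedMatrix_ne_zero
    (D := fun L => w L * (α L + (-α L₀ / β L₀) * β L) ^ 2) (b := b)
    (fun L => mul_nonneg (hw L).le (sq_nonneg _)) L₀
    (fun L hL => mul_pos (hw L) (pow_two_pos_of_ne_zero fun h => hαβ L L₀ hL (by
      have := hβ L₀
      field_simp at h
      linear_combination h))) (hb L₀) hspan
  rw [← Complex.ofReal_ne_zero, ← Complex.ofRealHom_eq_coe, map_det_borderedMatrix] at h
  refine h ?_
  have ht' : q.eval t = 0 := ht
  rw [hq, htr] at ht'
  simpa using ht'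

lemma exists_complex_degenerate {ι : Type*} [Fintype ι] {d : ℕ}
    {b : ι → Fin d → ℝ} {m : ι → ℝ} (hcard : d < Fintype.card ι) (hm : ∀ L, 0 < m L)
    (hb : ∀ L, b L ≠ 0) (hspan : ∀ y : Fin d → ℝ, (∀ L, ∑ i, b L i * y i = 0) → y = 0)
    (hpar : ∀ L L', L ≠ L' → ∀ s t : ℝ, t ≠ 0 → t • b L ≠ s • b L') :
    ∃ z y : Fin d → ℂ, y ≠ 0 ∧ (∀ L, ∑ i, (b L i : ℂ) * z i ≠ 0) ∧
      ∀ i, ∑ L, m L * ((∑ k, (b L k : ℂ) * y k) / (∑ k, (b L k : ℂ) * z k) ^ 2 * b L i) = 0 := by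
  classical
  have hgen : ∀ {κ : Type _} [Finite κ] (c : κ → Fin d → ℝ), (∀ k, c k ≠ 0) →
      ∃ p : Fin d → ℝ, ∀ k, ∑ i, c k i * p i ≠ 0 := by
    intro κ _ c hc
    obtain ⟨φ, hφ⟩ := Module.exists_dual_forall_apply_ne_zero (K := ℝ) c hc
    refine ⟨fun i => φ (Pi.single i 1), fun k => ?_⟩
    have hsingle : ∀ i : Fin d, (Pi.single i 1 : Fin d → ℝ) = fun j => if i = j then 1 else 0 :=
      fun i => funext fun j => by simp [Pi.single_apply, eq_comm]
    simpa only [hsingle, ← smul_eq_mul, ← LinearMap.pi_apply_eq_sum_univ φ] using hφ k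
  obtain ⟨v, hv⟩ := hgen b hb
  obtain ⟨p, hp⟩ := hgen (κ := {x : ι × ι // x.1 ≠ x.2})
    (fun x => (∑ i, b x.1.2 i * v i) • b x.1.1 - (∑ i, b x.1.1 i * v i) • b x.1.2)
    (fun x => sub_ne_zero.mpr (hpar _ _ x.2 _ _ (hv _)))
  obtain ⟨t, hdet, ht⟩ := exists_root_det_borderedMatrix (b := Matrix.of b) (w := fun L => (m L)⁻¹)
    (α := fun L => ∑ i, b L i * p i) (β := fun L => ∑ i, b L i * v i) hcard
    (fun L => inv_pos.mpr (hm L)) hb hspan hv (fun L L' hL h => hp ⟨(L, L'), hL⟩ (by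
      simp only [Pi.sub_apply, Pi.smul_apply, smul_eq_mul, sub_mul, Finset.sum_sub_distrib,
        mul_assoc, ← Finset.mul_sum]
      linear_combination h))
  have hz : ∀ L, ∑ i, (b L i : ℂ) * (p i + t * v i) =
      ((∑ i, b L i * p i : ℝ) : ℂ) + t * ((∑ i, b L i * v i : ℝ) : ℂ) := by
    intro L
    push_cast
    rw [Finset.mul_sum, ← Finset.sum_add_distrib]
    exact Finset.sum_congr rfl fun i _ => by ring
  obtain ⟨x, y, hxy, h₁, h₂⟩ := exists_of_det_borderedMatrix_eq_zero hdet
  simp only [Matrix.map_apply, Matrix.of_apply, Complex.ofRealHom_eq_coe, ← hz] at h₁ h₂ ht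
  have hm' : ∀ L, (m L : ℂ) ≠ 0 := fun L => Complex.ofReal_ne_zero.mpr (hm L).ne'
  refine ⟨fun i => p i + t * v i, y, fun hy => ?_, ht, fun i => ?_⟩
  · refine hxy.elim (fun hx => hx (funext fun L => ?_)) fun h => h hy
    have := h₁ L
    simpa [hy, hm' L, ht L] using this
  · rw [← neg_eq_zero, ← Finset.sum_neg_distrib, ← h₂ i]
    refine Finset.sum_congr rfl fun L _ => ?_
    have h := h₁ L
    have := hm' L
    have := ht L
    generalize ∑ k, (b L k : ℂ) * (p k + t * v k) = u at *
    generalize ∑ k, (b L k : ℂ) * y k = e at *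
    push_cast at h
    field_simp at h ⊢
    linear_combination (-(b L i : ℂ)) * h

lemma eval_pderiv_prod {σ κ K : Type*} [Field K] (s : Finset κ) (p : κ → MvPolynomial σ K)
    (z : σ → K) (hz : ∀ k ∈ s, eval z (p k) ≠ 0) (i : σ) :
    eval z (pderiv i (∏ k ∈ s, p k)) =
      eval z (∏ k ∈ s, p k) * ∑ k ∈ s, eval z (pderiv i (p k)) / eval z (p k) := by
  classical
  induction s using Finset.induction_on with
  | empty => simp
  | insert a s ha ih =>
    have h₀ := hz a (Finset.mem_insert_self a s)
    rw [Finset.prod_insert ha, Finset.sum_insert ha]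
    simp only [pderiv_mul, map_add, map_mul, ih fun k hk => hz k (Finset.mem_insert_of_mem hk)]
    field_simp

lemma eval_pderiv_pderiv_prod {σ κ K : Type*} [Field K] (s : Finset κ) (p : κ → MvPolynomial σ K)
    (z : σ → K) (hz : ∀ k ∈ s, eval z (p k) ≠ 0) (i j : σ)
    (hp : ∀ k ∈ s, pderiv i (pderiv j (p k)) = 0) :
    eval z (pderiv i (pderiv j (∏ k ∈ s, p k))) =
      eval z (∏ k ∈ s, p k) *
        ((∑ k ∈ s, eval z (pderiv i (p k)) / eval z (p k)) *
          (∑ k ∈ s, eval z (pderiv j (p k)) / eval z (p k)) -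
          ∑ k ∈ s, eval z (pderiv i (p k)) * eval z (pderiv j (p k)) / eval z (p k) ^ 2) := by
  classical
  induction s using Finset.induction_on with
  | empty => simp
  | insert a s ha ih =>
    have h₀ := hz a (Finset.mem_insert_self a s)
    have hz' := fun k hk => hz k (Finset.mem_insert_of_mem hk)
    rw [Finset.prod_insert ha, Finset.sum_insert ha, Finset.sum_insert ha, Finset.sum_insert ha]
    simp only [pderiv_mul, map_add, map_mul, hp a (Finset.mem_insert_self a s),
      ih hz' fun k hk => hp k (Finset.mem_insert_of_mem hk), eval_pderiv_prod s p z hz', map_zero]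
    field_simp
    ring

lemma det_hessian_eq_zero {d n : ℕ} (a : Matrix (Fin d) (Fin n) ℂ) (z y : Fin d → ℂ) (hy : y ≠ 0)
    (hz : ∀ k, ∑ i, a i k * z i ≠ 0)
    (h : ∀ i, ∑ k, (∑ j, a j k * y j) / (∑ j, a j k * z j) ^ 2 * a i k = 0) :
    eval z (Matrix.det (Matrix.of fun i j : Fin d =>
      pderiv i (pderiv j (∏ k : Fin n, ∑ i' : Fin d, C (a i' k) * X i')))) = 0 := by
  classical
  have heval : ∀ k, eval z (∑ i', C (a i' k) * X i') = ∑ i, a i k * z i := fun k => by simp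
  have hpd : ∀ j k, pderiv j (∑ i', C (a i' k) * X i') = C (a j k) := by
    intro j k
    simp [pderiv_X, Pi.single_apply]
  have hess := fun i j => eval_pderiv_pderiv_prod Finset.univ
    (fun k => ∑ i', C (a i' k) * X i') z (fun k _ => by rw [heval]; exact hz k) i j
    (fun k _ => by simp [hpd])
  simp only [hpd, heval, eval_C] at hess
  have hlin : ∑ k, (∑ j, a j k * y j) / (∑ j, a j k * z j) = 0 := by
    calc _ = ∑ k, ∑ i, z i * ((∑ j, a j k * y j) / (∑ j, a j k * z j) ^ 2 * a i k) := by
          refine Finset.sum_congr rfl fun k _ => ?_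
          have h₀ := hz k
          rw [show ∑ i, z i * ((∑ j, a j k * y j) / (∑ j, a j k * z j) ^ 2 * a i k) =
            (∑ j, a j k * y j) / (∑ j, a j k * z j) ^ 2 * ∑ i, a i k * z i by
              rw [Finset.mul_sum]
              exact Finset.sum_congr rfl fun i _ => by ring]
          field_simp
      _ = 0 := by
          rw [Finset.sum_comm]
          simp [← Finset.mul_sum, h]
  rw [RingHom.map_det]
  refine Matrix.exists_mulVec_eq_zero_iff.mp ⟨y, hy, funext fun i => ?_⟩
  simp only [Matrix.mulVec, dotProduct, RingHom.mapMatrix_apply, Matrix.map_apply, Matrix.of_apply,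
    hess, Pi.zero_apply]
  have e₁ : ∑ j, (∑ k, a j k / ∑ j, a j k * z j) * y j = 0 := by
    rw [← hlin]
    simp only [Finset.sum_mul, Finset.sum_div]
    rw [Finset.sum_comm]
    exact Finset.sum_congr rfl fun k _ => Finset.sum_congr rfl fun j _ => by ring
  have e₂ : ∑ j, (∑ k, a i k * a j k / (∑ j, a j k * z j) ^ 2) * y j = 0 := by
    rw [← h i]
    simp only [Finset.sum_mul, Finset.sum_div]
    rw [Finset.sum_comm]
    exact Finset.sum_congr rfl fun k _ => Finset.sum_congr rfl fun j _ => by ring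
  simp only [mul_sub, sub_mul, Finset.sum_sub_distrib, mul_assoc, ← Finset.mul_sum, e₁, e₂,
    mul_zero, sub_zero]

/-- If the columns of a rank-`d` real `d×n` matrix `A` (none zero) span at least `d+1`
distinct lines through the origin (i.e. `A` is not basic), then the complex hypersurface
defined by the Hessian determinant of `f = ∏ ℓⱼ` is not contained in `{f = 0}`. -/
theorem stmt_1 (d n : ℕ) (hd : 2 ≤ d) (A : Matrix (Fin d) (Fin n) ℝ)
    (hrank : A.rank = d) (hcols : ∀ j : Fin n, (fun i => A i j) ≠ 0)
    (hnonbasic : d + 1 ≤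
      (Set.range fun j : Fin n => Submodule.span ℝ {fun i : Fin d => A i j}).ncard) :
    ∃ z : Fin d → ℂ,
      eval z (Matrix.det (Matrix.of fun i j : Fin d =>
        pderiv i (pderiv j (∏ k : Fin n, ∑ i' : Fin d, C ((A i' k : ℂ)) * X i')))) = 0 ∧
      eval z (∏ k : Fin n, ∑ i' : Fin d, C ((A i' k : ℂ)) * X i') ≠ 0 := by
  classical
  let line : Fin n → Submodule ℝ (Fin d → ℝ) := fun j => Submodule.span ℝ {fun i => A i j}
  let cls : Fin n → Set.range line := fun j => ⟨line j, j, rfl⟩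
  choose rep hrep using fun L : Set.range line => L.2
  let b : Set.range line → Fin d → ℝ := fun L i => A i (rep L)
  let m : Set.range line → ℝ := fun L => (Finset.univ.filter fun j => cls j = L).card
  have hscale : ∀ j, ∃ c : ℝ, c ≠ 0 ∧ ∀ i, A i j = c * b (cls j) i := by
    intro j
    have hmem : (fun i => A i j) ∈ Submodule.span ℝ {b (cls j)} := by
      rw [show Submodule.span ℝ {b (cls j)} = line j from hrep (cls j)]
      exact Submodule.mem_span_singleton_self _
    obtain ⟨c, hc⟩ := Submodule.mem_span_singleton.mp hmem
    refine ⟨c, fun h₀ => hcols j (by rw [← hc, h₀, zero_smul]), fun i => (congrFun hc i).symm⟩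
  choose c hc₀ hc using hscale
  have hb : ∀ L, b L ≠ 0 := fun L => hcols (rep L)
  have hm : ∀ L, 0 < m L := fun L => by
    refine Nat.cast_pos.mpr (Finset.card_pos.mpr ⟨rep L, ?_⟩)
    simpa [cls] using Subtype.ext (hrep L)
  have hspan : ∀ y : Fin d → ℝ, (∀ L, ∑ i, b L i * y i = 0) → y = 0 := by
    intro y hy
    have hli : LinearIndependent ℝ A.row := by
      rw [linearIndependent_iff_card_eq_finrank_span, Fintype.card_fin, Set.finrank,
        ← A.rank_eq_finrank_span_row, hrank]
    rw [Fintype.linearIndependent_iff] at hli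
    refine funext fun i => hli y (funext fun j => ?_) i
    have := hy (cls j)
    simp only [Finset.sum_apply, Pi.smul_apply, Matrix.row_apply, smul_eq_mul, Pi.zero_apply, hc j]
    rw [← mul_zero (c j), ← this, Finset.mul_sum]
    exact Finset.sum_congr rfl fun i _ => by ring
  have hpar : ∀ L L', L ≠ L' → ∀ s t : ℝ, t ≠ 0 → t • b L ≠ s • b L' := by
    intro L L' hL s t ht h
    have hs : s ≠ 0 := by
      rintro rfl
      exact (smul_ne_zero ht (hb L)) (by simpa using h)
    refine hL (Subtype.ext ?_)
    rw [← hrep L, ← hrep L']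
    change Submodule.span ℝ {b L} = Submodule.span ℝ {b L'}
    rw [← Submodule.span_singleton_smul_eq ht.isUnit, h,
      Submodule.span_singleton_smul_eq hs.isUnit]
  have hcard : d < Fintype.card (Set.range line) := by
    rw [← Nat.card_eq_fintype_card, Nat.card_coe_set_eq]
    exact hnonbasic
  obtain ⟨z, y, hy, hz, h⟩ := exists_complex_degenerate hcard hm hb hspan hpar
  have hform : ∀ j (u : Fin d → ℂ), ∑ i, (A i j : ℂ) * u i = c j * ∑ i, (b (cls j) i : ℂ) * u i := by
    intro j u
    rw [Finset.mul_sum]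
    exact Finset.sum_congr rfl fun i _ => by rw [hc j i]; push_cast; ring
  have hcC : ∀ j, (c j : ℂ) ≠ 0 := fun j => Complex.ofReal_ne_zero.mpr (hc₀ j)
  have hz' : ∀ j, ∑ i, (A i j : ℂ) * z i ≠ 0 := fun j => by
    rw [hform]
    exact mul_ne_zero (hcC j) (hz _)
  refine ⟨z, det_hessian_eq_zero (fun i j => (A i j : ℂ)) z y hy hz' fun i => ?_, ?_⟩
  · rw [← h i, ← Finset.sum_fiberwise Finset.univ cls]
    refine Finset.sum_congr rfl fun L _ => ?_
    rw [Finset.sum_congr rfl (g := fun _ => (∑ k, (b L k : ℂ) * y k) /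
      (∑ k, (b L k : ℂ) * z k) ^ 2 * b L i)]
    · simp [m]
    · intro j hj
      obtain rfl : cls j = L := (Finset.mem_filter.mp hj).2
      have := hcC j
      have := hz (cls j)
      rw [hform j y, hform j z, hc j i]
      push_cast
      field_simp
  · rw [map_prod]
    exact Finset.prod_ne_zero_iff.mpr fun j _ => by simpa using hz' j
end

section
/- Let d ≥ 1 and let E be the d×d matrix with all diagonal entries 2 and all off-diagonal entries 1 (the identity plus the all-ones matrix). Then: (a) for every b ∈ ℝ^d there exists λ ∈ ℝ^d such that det(t·E + diag(b_1,…,b_d)) = det(E)·∏_{i=1}^d (t − λ_i) as polynomials in t; and (b) there exist finitely many polynomials q_1,…,q_N ∈ ℚ[b_1,…,b_d] such that for every b ∈ ℝ^d and every λ ∈ ℝ^d satisfying the identity in (a), one has ∏_{1≤i<j≤d} (λ_i − λ_j)² = Σ_{k=1}^N q_k(b)². (This says that the entropic discriminant of the d×(d+1) matrix (I_d | −1), which equals the discriminant of det(tE + diag(b)), is a sum of squares of polynomials with rational coefficients.) -/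
open Matrix in
/-- A **Cauchy–Binet** formula, summed over all (not necessarily increasing) families of columns. -/
theorem Matrix.factorial_mul_det_mul_transpose {m n R : Type*} [Fintype m] [DecidableEq m]
    [Fintype n] [CommRing R] (V : Matrix m n R) :
    ((Fintype.card m).factorial : R) * (V * Vᵀ).det =
      ∑ f : m → n, (V.submatrix id f).det ^ 2 := by
  classical
  have expand : (V * Vᵀ).det = ∑ f : m → n, (∏ i, V i (f i)) * (V.submatrix id f).det := by
    have hrow : V * Vᵀ = fun i => ∑ k, V i k • Vᵀ k := by
      ext i j
      simp [Matrix.mul_apply, Finset.sum_apply]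
    change (detRowAlternating : (m → R) [⋀^m]→ₗ[R] R).toMultilinearMap (V * Vᵀ) = _
    rw [hrow, MultilinearMap.map_sum]
    refine Finset.sum_congr rfl fun f _ => ?_
    rw [MultilinearMap.map_smul_univ, smul_eq_mul, ← det_transpose (V.submatrix id f)]
    rfl
  have perm (σ : Equiv.Perm m) :
      ∑ f : m → n, (Equiv.Perm.sign σ : R) * (∏ i, V (σ i) (f i)) * (V.submatrix id f).det =
        (V * Vᵀ).det := by
    rw [expand, ← Equiv.sum_comp (σ.arrowCongr (Equiv.refl n)).symm]
    refine Finset.sum_congr rfl fun g _ => ?_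
    have h1 : V.submatrix id ((σ.arrowCongr (Equiv.refl n)).symm g) =
        (V.submatrix id g).submatrix id σ := rfl
    have h2 : ∏ i, V (σ i) ((σ.arrowCongr (Equiv.refl n)).symm g i) = ∏ i, V i (g i) :=
      Equiv.prod_comp σ fun i => V i (g i)
    have h3 : ((Equiv.Perm.sign σ : ℤ) : R) * ((Equiv.Perm.sign σ : ℤ) : R) = 1 := by
      rw [← Int.cast_mul, ← Units.val_mul, Int.units_mul_self]
      simp
    rw [h1, h2, det_permute']
    linear_combination (∏ i, V i (g i)) * (V.submatrix id g).det * h3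
  calc ((Fintype.card m).factorial : R) * (V * Vᵀ).det
      = ∑ σ : Equiv.Perm m, (V * Vᵀ).det := by simp [Fintype.card_perm]
    _ = ∑ σ : Equiv.Perm m, ∑ f : m → n,
          (Equiv.Perm.sign σ : R) * (∏ i, V (σ i) (f i)) * (V.submatrix id f).det :=
        Finset.sum_congr rfl fun σ _ => (perm σ).symm
    _ = _ := by
        rw [Finset.sum_comm]
        refine Finset.sum_congr rfl fun f _ => ?_
        rw [← Finset.sum_mul, sq]
        congr 1
        rw [det_apply']
        rfl

theorem Matrix.trace_mul_pow_comm {n R : Type*} [Fintype n] [DecidableEq n] [CommRing R]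
    (A B : Matrix n n R) (k : ℕ) : ((A * B) ^ k).trace = ((B * A) ^ k).trace := by
  cases k with
  | zero => simp
  | succ k =>
    have h : A * (B * A) ^ k = (A * B) ^ k * A :=
      (show SemiconjBy A (B * A) (A * B) from (mul_assoc A B A).symm).pow_right k
    rw [pow_succ, ← mul_assoc, ← h, Matrix.trace_mul_comm, ← mul_assoc, pow_succ']

open Unitary in
theorem Matrix.IsHermitian.trace_pow_eq_sum_eigenvalues {n : Type*} [Fintype n] [DecidableEq n]
    {S : Matrix n n ℝ} (hS : S.IsHermitian) (k : ℕ) :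
    (S ^ k).trace = ∑ i, hS.eigenvalues i ^ k := by
  conv_lhs => rw [hS.spectral_theorem, ← map_pow, conjStarAlgAut_apply, Matrix.trace_mul_comm,
    ← mul_assoc]
  simp [Matrix.diagonal_pow, Matrix.trace]

open Polynomial in
theorem Matrix.PosSemidef.exists_charpoly_mul_eq_prod {n : Type*} [Fintype n] [DecidableEq n]
    {G D : Matrix n n ℝ} (hG : G.PosSemidef) (hD : D.IsHermitian) :
    ∃ μ : n → ℝ, (G * D).charpoly = ∏ i, (X - C (μ i)) ∧
      ∀ k : ℕ, ((G * D) ^ k).trace = ∑ i, μ i ^ k := by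
  open scoped MatrixOrder Matrix.Norms.L2Operator in
  obtain ⟨P, rfl⟩ := CStarAlgebra.nonneg_iff_eq_star_mul_self.mp hG.nonneg
  have hS : (P * D * star P).IsHermitian := Matrix.isHermitian_mul_mul_conjTranspose P hD
  refine ⟨hS.eigenvalues, ?_, fun k => ?_⟩
  · rw [mul_assoc, Matrix.charpoly_mul_comm, hS.charpoly_eq]
    rfl
  · rw [mul_assoc, Matrix.trace_mul_pow_comm, hS.trace_pow_eq_sum_eigenvalues]

open Polynomial in
/-- The discriminant of a characteristic polynomial as the determinant of the trace form. -/
theorem Matrix.PosSemidef.prod_sub_sq_eq_det_trace {d : ℕ}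
    {G D : Matrix (Fin d) (Fin d) ℝ} (hG : G.PosSemidef) (hD : D.IsHermitian) {l : Fin d → ℝ}
    (hl : (G * D).charpoly = ∏ i, (X - C (l i))) :
    ∏ p ∈ Finset.univ.filter (fun p : Fin d × Fin d => p.1 < p.2), (l p.1 - l p.2) ^ 2 =
      (Matrix.of fun i j : Fin d => ((G * D) ^ (i + j : ℕ)).trace).det := by
  obtain ⟨μ, hμ, htr⟩ := hG.exists_charpoly_mul_eq_prod hD
  have hroots : Finset.univ.val.map l = Finset.univ.val.map μ := by
    have key (v : Fin d → ℝ) : (∏ i, (X - C (v i))).roots = Finset.univ.val.map v := by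
      rw [← roots_multiset_prod_X_sub_C (Finset.univ.val.map v), Multiset.map_map]
      rfl
    rw [← key, ← key, ← hl, hμ]
  have hsum (k : ℕ) : ((G * D) ^ k).trace = ∑ i, l i ^ k := by
    rw [htr]
    have := congrArg (fun s => (s.map (· ^ k)).sum) hroots
    simp only [Multiset.map_map] at this
    exact this.symm
  have hvan : (Matrix.of fun i j : Fin d => ((G * D) ^ (i + j : ℕ)).trace) =
      (Matrix.vandermonde l).transpose * Matrix.vandermonde l := by
    ext i j
    rw [Matrix.vandermonde_transpose_mul_vandermonde, Matrix.of_apply, hsum]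
  rw [hvan, Matrix.det_mul, Matrix.det_transpose, Matrix.det_vandermonde, ← sq,
    ← Finset.prod_pow, Finset.prod_filter, Fintype.prod_prod_type]
  refine Finset.prod_congr rfl fun i _ => ?_
  rw [← Finset.prod_pow, ← Finset.prod_filter]
  refine Finset.prod_congr (by ext; simp) fun j _ => ?_
  ring

open Matrix in
/-- If `G` is symmetric with inverse `B * Bᵀ` and `D` is symmetric, the trace form of `G * D` on
powers of `G * D` is a Gram matrix. -/
theorem Matrix.trace_mul_pow_add_eq {n m R : Type*} [Fintype n] [DecidableEq n] [Fintype m]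
    [CommRing R] {G D : Matrix n n R} {B : Matrix n m R} (hG : G.IsSymm) (hD : D.IsSymm)
    (hGB : G * (B * Bᵀ) = 1) (i j : ℕ) :
    ((G * D) ^ (i + j)).trace =
      ((Bᵀ * (G * D) ^ i * (G * B)) * (Bᵀ * (G * D) ^ j * (G * B))ᵀ).trace := by
  have hBG : B * Bᵀ * G = 1 := mul_eq_one_comm.mp hGB
  have hsemi : G * ((G * D) ^ j)ᵀ = (G * D) ^ j * G := by
    rw [transpose_pow, transpose_mul, hG.eq, hD.eq]
    exact (show SemiconjBy G (D * G) (G * D) from (mul_assoc G D G).symm).pow_right j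
  symm
  calc ((Bᵀ * (G * D) ^ i * (G * B)) * (Bᵀ * (G * D) ^ j * (G * B))ᵀ).trace
      = (Bᵀ * ((G * D) ^ i * G * (B * Bᵀ * G) * ((G * D) ^ j)ᵀ * B)).trace := by
        simp only [transpose_mul, transpose_transpose, hG.eq, Matrix.mul_assoc]
    _ = ((G * D) ^ i * (G * ((G * D) ^ j)ᵀ) * (B * Bᵀ)).trace := by
        rw [trace_mul_comm, hBG]
        simp only [Matrix.mul_assoc, Matrix.mul_one]
    _ = ((G * D) ^ (i + j)).trace := by
        rw [hsemi, Matrix.mul_assoc, Matrix.mul_assoc, hGB, Matrix.mul_one, pow_add]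

open Matrix in
/-- Over a `ℚ`-algebra, the determinant of the trace form on powers of `G * D` is a
sum of squares. -/
theorem Matrix.exists_det_trace_eq_sum_sq {d : ℕ} {m R : Type*} [Fintype m] [CommRing R]
    [Algebra ℚ R] {G D : Matrix (Fin d) (Fin d) R} {B : Matrix (Fin d) m R} (hG : G.IsSymm)
    (hD : D.IsSymm) (hGB : G * (B * Bᵀ) = 1) :
    ∃ (N : ℕ) (q : Fin N → R),
      (Matrix.of fun i j : Fin d => ((G * D) ^ (i + j : ℕ)).trace).det = ∑ k, q k ^ 2 := by
  let V : Matrix (Fin d) (m × m) R :=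
    Matrix.of fun i p => (Bᵀ * (G * D) ^ (i : ℕ) * (G * B)) p.1 p.2
  have hV : (Matrix.of fun i j : Fin d => ((G * D) ^ (i + j : ℕ)).trace) = V * Vᵀ := by
    ext i j
    rw [Matrix.of_apply, trace_mul_pow_add_eq hG hD hGB, Matrix.mul_apply, Fintype.sum_prod_type]
    rfl
  let c : R := algebraMap ℚ R (d.factorial : ℚ)⁻¹
  have hc : c * (d.factorial : R) = 1 := by
    rw [← map_natCast (algebraMap ℚ R), ← map_mul,
      inv_mul_cancel₀ (Nat.cast_ne_zero.mpr d.factorial_ne_zero), map_one]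
  classical
  let e := Fintype.equivFin ((Fin d → m × m) × Fin d.factorial)
  refine ⟨_, fun k => c * (V.submatrix id (e.symm k).1).det, ?_⟩
  rw [Equiv.sum_comp e.symm (fun x => (c * (V.submatrix id x.1).det) ^ 2), Fintype.sum_prod_type]
  have hcb := factorial_mul_det_mul_transpose V
  rw [Fintype.card_fin] at hcb
  simp only [Finset.sum_const, Finset.card_univ, Fintype.card_fin, nsmul_eq_mul, mul_pow]
  rw [← Finset.mul_sum, ← Finset.mul_sum, ← hcb, hV]
  linear_combination (-(c * d.factorial) - 1) * (V * Vᵀ).det * hc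

/-- The inverse of `1 + J`, where `J` is the all-ones matrix of size `d`. -/
def invOneAddOnes (d : ℕ) (R : Type*) [CommRing R] [Algebra ℚ R] : Matrix (Fin d) (Fin d) R :=
  1 - Matrix.of fun _ _ => algebraMap ℚ R ((d : ℚ) + 1)⁻¹

/-- The matrix `(I | 1)`. -/
def identityWithOnes (d : ℕ) (R : Type*) [CommRing R] : Matrix (Fin d) (Fin d ⊕ Unit) R :=
  Matrix.fromCols 1 (Matrix.of fun _ _ => 1)

section

variable (d : ℕ) (R : Type*) [CommRing R]

open Matrix in
theorem identityWithOnes_mul_transpose :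
    identityWithOnes d R * (identityWithOnes d R)ᵀ = 1 + Matrix.of fun _ _ => 1 := by
  rw [identityWithOnes, transpose_fromCols, fromCols_mul_fromRows]
  ext i j
  simp [Matrix.mul_apply]

variable [Algebra ℚ R]

theorem invOneAddOnes_isSymm : (invOneAddOnes d R).IsSymm := by
  ext i j
  simp [invOneAddOnes, Matrix.one_apply, eq_comm]

open Matrix in
theorem invOneAddOnes_mul :
    invOneAddOnes d R * (identityWithOnes d R * (identityWithOnes d R)ᵀ) = 1 := by
  have h : algebraMap ℚ R ((d : ℚ) + 1)⁻¹ * ((d : R) + 1) = 1 := by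
    rw [← map_natCast (algebraMap ℚ R), ← map_one (algebraMap ℚ R), ← map_add, ← map_mul,
      inv_mul_cancel₀ (by positivity)]
  rw [identityWithOnes_mul_transpose, invOneAddOnes, sub_mul, one_mul, mul_add, mul_one]
  ext i j
  simp only [Matrix.sub_apply, Matrix.add_apply, of_apply, Matrix.mul_apply, mul_one, Finset.sum_const,
    Finset.card_univ, Fintype.card_fin, nsmul_eq_mul]
  linear_combination -h

end

open Matrix in
theorem invOneAddOnes_posSemidef (d : ℕ) : (invOneAddOnes d ℝ).PosSemidef := by
  have h := posSemidef_self_mul_conjTranspose (invOneAddOnes d ℝ * identityWithOnes d ℝ)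
  rwa [conjTranspose_mul, conjTranspose_eq_transpose_of_trivial,
    conjTranspose_eq_transpose_of_trivial, ← Matrix.mul_assoc, Matrix.mul_assoc (invOneAddOnes d ℝ),
    invOneAddOnes_mul, Matrix.one_mul, (invOneAddOnes_isSymm d ℝ).eq] at h

theorem map_invOneAddOnes {R S : Type*} [CommRing R] [Algebra ℚ R] [CommRing S] [Algebra ℚ S]
    (f : R →ₐ[ℚ] S) (d : ℕ) : f.mapMatrix (invOneAddOnes d R) = invOneAddOnes d S := by
  rw [invOneAddOnes, map_sub, map_one, invOneAddOnes]
  congr 1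
  ext i j
  exact f.commutes _

open Matrix Polynomial in
theorem det_pencil_eq_det_mul_charpoly {n R : Type*} [Fintype n] [DecidableEq n] [CommRing R]
    {E G : Matrix n n R} (hEG : E * G = 1) (D : Matrix n n R) :
    (Matrix.of fun i j => C (E i j) * X + C (D i j)).det = C E.det * (G * -D).charpoly := by
  have h : (Matrix.of fun i j => C (E i j) * X + C (D i j)) =
      C.mapMatrix E * charmatrix (G * -D) := by
    rw [charmatrix, mul_sub, ← map_mul, ← Matrix.mul_assoc, hEG, Matrix.one_mul]
    ext i j : 2
    simp [Matrix.scalar_apply]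
  rw [h, det_mul, charpoly, RingHom.map_det]

/-- For `E = I + (all-ones)`: (a) `det(tE + diag b)` splits over `ℝ` as
`det E · ∏ (t − λᵢ)`, and (b) the squared differences product `∏_{i<j} (λᵢ − λⱼ)²`
is a sum of squares of rational polynomials evaluated at `b`. -/
theorem stmt_4 (d : ℕ) (hd : 1 ≤ d) (E : Matrix (Fin d) (Fin d) ℝ)
    (hE : ∀ i j, E i j = if i = j then 2 else 1) :
    (∀ b : Fin d → ℝ, ∃ l : Fin d → ℝ,
      (Matrix.of fun i j : Fin d =>
          Polynomial.C (E i j) * Polynomial.X + Polynomial.C (Matrix.diagonal b i j)).det =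
        Polynomial.C E.det * ∏ i : Fin d, (Polynomial.X - Polynomial.C (l i))) ∧
    (∃ (N : ℕ) (q : Fin N → MvPolynomial (Fin d) ℚ),
      ∀ (b l : Fin d → ℝ),
        (Matrix.of fun i j : Fin d =>
            Polynomial.C (E i j) * Polynomial.X + Polynomial.C (Matrix.diagonal b i j)).det =
          Polynomial.C E.det * ∏ i : Fin d, (Polynomial.X - Polynomial.C (l i)) →
        ∏ p ∈ Finset.univ.filter (fun p : Fin d × Fin d => p.1 < p.2), (l p.1 - l p.2) ^ 2 =
          ∑ k : Fin N, (MvPolynomial.aeval b (q k)) ^ 2) := by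
  have hEB : E = identityWithOnes d ℝ * (identityWithOnes d ℝ).transpose := by
    rw [identityWithOnes_mul_transpose]
    ext i j
    rw [hE, Matrix.add_apply, Matrix.one_apply, Matrix.of_apply]
    split_ifs <;> norm_num
  have hGE : invOneAddOnes d ℝ * E = 1 := hEB ▸ invOneAddOnes_mul d ℝ
  have hEG : E * invOneAddOnes d ℝ = 1 := mul_eq_one_comm.mp hGE
  have hE0 : Polynomial.C E.det ≠ 0 := by
    rw [Ne, Polynomial.C_eq_zero]
    intro h
    have := congrArg Matrix.det hEG
    rw [Matrix.det_mul, h, zero_mul, Matrix.det_one] at this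
    exact zero_ne_one this
  have hherm (b : Fin d → ℝ) : (-Matrix.diagonal b).IsHermitian :=
    (Matrix.isHermitian_diagonal b).neg
  have hpsd := invOneAddOnes_posSemidef d
  refine ⟨fun b => ?_, ?_⟩
  · obtain ⟨μ, hμ, -⟩ := hpsd.exists_charpoly_mul_eq_prod (hherm b)
    exact ⟨μ, by rw [det_pencil_eq_det_mul_charpoly hEG, hμ]⟩
  · let D : Matrix (Fin d) (Fin d) (MvPolynomial (Fin d) ℚ) := -Matrix.diagonal MvPolynomial.X
    have hD : D.IsSymm := (Matrix.isSymm_diagonal _).neg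
    obtain ⟨N, q, hq⟩ := Matrix.exists_det_trace_eq_sum_sq
      (invOneAddOnes_isSymm d (MvPolynomial (Fin d) ℚ)) hD (invOneAddOnes_mul d _)
    refine ⟨N, q, fun b l h => ?_⟩
    rw [det_pencil_eq_det_mul_charpoly hEG] at h
    rw [hpsd.prod_sub_sq_eq_det_trace (hherm b) (mul_left_cancel₀ hE0 h)]
    have hmap := congrArg (MvPolynomial.aeval (R := ℚ) b) hq
    simp only [map_sum, map_pow] at hmap
    rw [← hmap, AlgHom.map_det]
    congr 1
    ext i j
    have hDmap : (MvPolynomial.aeval (R := ℚ) b).mapMatrix D = -Matrix.diagonal b := by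
      rw [map_neg]
      congr 1
      ext i j
      by_cases hij : i = j <;> simp [hij]
    rw [Matrix.of_apply, ← hDmap, ← map_invOneAddOnes (MvPolynomial.aeval (R := ℚ) b), ← map_mul,
      ← map_pow]
    simp [Matrix.trace]
end

section
/- Let A be a real d×n matrix of rank d with no zero columns. The following are equivalent: (i) μ(A) = 1, i.e. the Möbius function of the lattice of flats of A satisfies |μ(∅, {1,…,n})| = 1; (ii) A is basic, i.e. the columns of A span exactly d distinct lines through the origin of ℝ^d; (iii) the lattice of flats of A is order-isomorphic to the Boolean lattice of all subsets of a d-element set. -/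
open scoped Classical

/-- The `j`-th column of `A`. -/
def matCol {d n : ℕ} (A : Matrix (Fin d) (Fin n) ℝ) (j : Fin n) : Fin d → ℝ :=
  fun i => A i j

/-- `J` is a flat of `A` if `J = {i : Aᵢ ∈ span{Aⱼ : j ∈ J}}`. -/
def IsFlat {d n : ℕ} (A : Matrix (Fin d) (Fin n) ℝ) (J : Finset (Fin n)) : Prop :=
  ∀ i : Fin n, i ∈ J ↔ matCol A i ∈ Submodule.span ℝ (matCol A '' ↑J)

/-- The closure of a set of column indices: all columns lying in the span. -/
noncomputable def colClosure {d n : ℕ} (A : Matrix (Fin d) (Fin n) ℝ) (S : Finset (Fin n)) :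
    Finset (Fin n) :=
  Finset.univ.filter fun i => matCol A i ∈ Submodule.span ℝ (matCol A '' ↑S)

/-- The line spanned by a column. -/
noncomputable def colLine {d n : ℕ} (A : Matrix (Fin d) (Fin n) ℝ) (j : Fin n) :
    Submodule ℝ (Fin d → ℝ) :=
  Submodule.span ℝ {matCol A j}

/-- The rank of a set of columns. -/
noncomputable def colRank {d n : ℕ} (A : Matrix (Fin d) (Fin n) ℝ) (S : Finset (Fin n)) : ℕ :=
  Module.finrank ℝ (Submodule.span ℝ (matCol A '' ↑S))

section Flats

variable {d n : ℕ} {A : Matrix (Fin d) (Fin n) ℝ}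

theorem mem_colClosure {S : Finset (Fin n)} {i : Fin n} :
    i ∈ colClosure A S ↔ matCol A i ∈ Submodule.span ℝ (matCol A '' ↑S) := by
  simp [colClosure]

theorem subset_colClosure (S : Finset (Fin n)) : S ⊆ colClosure A S := fun i hi =>
  mem_colClosure.2 (Submodule.subset_span ⟨i, hi, rfl⟩)

theorem span_colClosure (S : Finset (Fin n)) :
    Submodule.span ℝ (matCol A '' ↑(colClosure A S)) = Submodule.span ℝ (matCol A '' ↑S) := by
  apply le_antisymm
  · rw [Submodule.span_le]
    rintro _ ⟨i, hi, rfl⟩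
    exact mem_colClosure.1 hi
  · exact Submodule.span_mono (Set.image_mono (subset_colClosure S))

theorem isFlat_colClosure (S : Finset (Fin n)) : IsFlat A (colClosure A S) := fun i => by
  rw [span_colClosure, mem_colClosure]

theorem IsFlat.colClosure_subset {F S : Finset (Fin n)} (hF : IsFlat A F) (h : S ⊆ F) :
    colClosure A S ⊆ F := fun i hi =>
  (hF i).2 (Submodule.span_mono (Set.image_mono h) (mem_colClosure.1 hi))

theorem isFlat_univ : IsFlat A Finset.univ := fun i =>
  ⟨fun _ => Submodule.subset_span ⟨i, by simp, rfl⟩, fun _ => Finset.mem_univ i⟩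

theorem isFlat_empty (hcol : ∀ j, matCol A j ≠ 0) : IsFlat A ∅ := fun i => by
  simp [hcol i]

theorem IsFlat.mem_of_colLine_eq {F : Finset (Fin n)} (hF : IsFlat A F) {i j : Fin n}
    (h : colLine A i = colLine A j) (hj : j ∈ F) : i ∈ F := by
  rw [hF i]
  have hi : matCol A i ∈ colLine A j := h ▸ Submodule.mem_span_singleton_self _
  refine Submodule.span_mono ?_ hi
  rintro _ rfl
  exact ⟨j, hj, rfl⟩

theorem colLine_eq_of_mem {i j : Fin n} (hi : matCol A i ≠ 0) (h : matCol A i ∈ colLine A j) :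
    colLine A i = colLine A j := by
  obtain ⟨c, hc⟩ := Submodule.mem_span_singleton.1 h
  have hc0 : c ≠ 0 := by
    rintro rfl
    exact hi (by rw [← hc, zero_smul])
  rw [colLine, ← hc, Submodule.span_singleton_smul_eq (IsUnit.mk0 c hc0), colLine]

/-- A subset of a flat `F` whose closure avoids `a ∈ F` extends to a flat in `F` that avoids `a` and
spans `F` together with `a`. -/
theorem IsFlat.exists_hyperplane {F S : Finset (Fin n)} (hF : IsFlat A F) {a : Fin n}
    (ha : a ∈ F) (hS : S ⊆ F) (haS : a ∉ colClosure A S) :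
    ∃ G, IsFlat A G ∧ S ⊆ G ∧ G ⊆ F ∧ a ∉ G ∧ colClosure A (insert a G) = F := by
  let P := F.powerset.filter fun G => IsFlat A G ∧ S ⊆ G ∧ a ∉ G
  have hP : P.Nonempty := ⟨colClosure A S, by
    simp only [P, Finset.mem_filter, Finset.mem_powerset]
    exact ⟨hF.colClosure_subset hS, isFlat_colClosure S, subset_colClosure S, haS⟩⟩
  obtain ⟨G, hGP, hmax⟩ := P.exists_max_image Finset.card hP
  simp only [P, Finset.mem_filter, Finset.mem_powerset] at hGP hmax
  obtain ⟨hGF, hG, hSG, haG⟩ := hGP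
  refine ⟨G, hG, hSG, hGF, haG, ?_⟩
  refine (hF.colClosure_subset (Finset.insert_subset ha hGF)).antisymm fun c hc => ?_
  by_contra hcG
  have hcG' : c ∉ G := fun h => hcG (subset_colClosure _ (Finset.mem_insert_of_mem h))
  have hGc : G ⊆ colClosure A (insert c G) :=
    (Finset.subset_insert c G).trans (subset_colClosure _)
  have hlt : G ⊂ colClosure A (insert c G) :=
    (Finset.ssubset_iff_of_subset hGc).2
      ⟨c, subset_colClosure _ (Finset.mem_insert_self c G), hcG'⟩
  have hac : a ∈ colClosure A (insert c G) := by
    by_contra hac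
    exact absurd (hmax _ ⟨hF.colClosure_subset (Finset.insert_subset hc hGF),
      isFlat_colClosure _, hSG.trans hGc, hac⟩) (Finset.card_lt_card hlt).not_ge
  rw [mem_colClosure, Finset.coe_insert, Set.image_insert_eq] at hac hcG
  exact hcG (mem_span_insert_exchange hac fun h => haG ((hG a).2 h))

theorem colRank_insert {G : Finset (Fin n)} (hG : IsFlat A G) {a : Fin n} (ha : a ∉ G) :
    colRank A (colClosure A (insert a G)) = colRank A G + 1 := by
  rw [colRank, span_colClosure, Finset.coe_insert, Set.image_insert_eq, colRank,
    Submodule.span_insert, sup_comm]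
  exact Submodule.finrank_sup_span_singleton fun h => ha ((hG a).2 h)

theorem colRank_univ : colRank A Finset.univ = A.rank := by
  rw [Matrix.rank_eq_finrank_span_cols, colRank, Finset.coe_univ, Set.image_univ]
  rfl

variable {μ : Finset (Fin n) → Finset (Fin n) → ℤ}

/-- Weisner's theorem for the lattice of flats. -/
theorem sum_filter_colClosure_insert_eq_zero (hcol : ∀ j, matCol A j ≠ 0)
    (hsum : ∀ F H, IsFlat A F → IsFlat A H → F ⊂ H →
      ∑ G ∈ H.powerset.filter (fun G => IsFlat A G ∧ F ⊆ G), μ F G = 0)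
    (a : Fin n) (F : Finset (Fin n)) (hF : IsFlat A F) (ha : a ∈ F) :
    ∑ G ∈ F.powerset.filter (fun G => IsFlat A G ∧ colClosure A (insert a G) = F), μ ∅ G = 0 := by
  induction F using Finset.strongInduction with
  | H F ih =>
  have h0 := hsum ∅ F (isFlat_empty hcol) hF (Finset.empty_ssubset.2 ⟨a, ha⟩)
  rw [← Finset.sum_fiberwise_of_maps_to
    (t := F.powerset.filter fun H => IsFlat A H ∧ a ∈ H)
    (g := fun G => colClosure A (insert a G))] at h0
  · rw [Finset.sum_eq_single F] at h0
    · rw [← h0]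
      refine Finset.sum_congr ?_ fun _ _ => rfl
      ext G
      simp only [Finset.mem_filter, Finset.mem_powerset, Finset.empty_subset, and_true]
      tauto
    · intro H hH hne
      simp only [Finset.mem_filter, Finset.mem_powerset] at hH
      rw [← ih H (hH.1.ssubset_of_ne hne) hH.2.1 hH.2.2]
      refine Finset.sum_congr ?_ fun _ _ => rfl
      ext G
      simp only [Finset.mem_filter, Finset.mem_powerset, Finset.empty_subset, and_true]
      constructor
      · rintro ⟨⟨_, hG⟩, rfl⟩
        exact ⟨(Finset.subset_insert a G).trans (subset_colClosure _), hG, rfl⟩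
      · rintro ⟨hGH, hG, h⟩
        exact ⟨⟨hGH.trans hH.1, hG⟩, h⟩
    · intro h
      exact absurd (by simp [hF, ha]) h
  · intro G hG
    simp only [Finset.mem_filter, Finset.mem_powerset] at hG ⊢
    exact ⟨hF.colClosure_subset (Finset.insert_subset ha hG.1), isFlat_colClosure _,
      subset_colClosure _ (Finset.mem_insert_self a G)⟩

/-- The Möbius function of a flat is the negated sum over the hyperplanes of that flat avoiding
a fixed element. -/
theorem moebius_eq_neg_sum_hyperplanes (hcol : ∀ j, matCol A j ≠ 0)
    (hsum : ∀ F H, IsFlat A F → IsFlat A H → F ⊂ H →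
      ∑ G ∈ H.powerset.filter (fun G => IsFlat A G ∧ F ⊆ G), μ F G = 0)
    {a : Fin n} {F : Finset (Fin n)} (hF : IsFlat A F) (ha : a ∈ F) :
    μ ∅ F = -∑ G ∈ F.powerset.filter
      (fun G => IsFlat A G ∧ a ∉ G ∧ colClosure A (insert a G) = F), μ ∅ G := by
  have h := sum_filter_colClosure_insert_eq_zero hcol hsum a F hF ha
  have hset : F.powerset.filter (fun G => IsFlat A G ∧ colClosure A (insert a G) = F) =
      insert F (F.powerset.filter
        (fun G => IsFlat A G ∧ a ∉ G ∧ colClosure A (insert a G) = F)) := by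
    ext G
    simp only [Finset.mem_filter, Finset.mem_powerset, Finset.mem_insert]
    constructor
    · rintro ⟨hGF, hG, h⟩
      by_cases haG : a ∈ G
      · left
        rw [Finset.insert_eq_of_mem haG] at h
        exact hGF.antisymm (h ▸ hG.colClosure_subset subset_rfl)
      · exact Or.inr ⟨hGF, hG, haG, h⟩
    · rintro (rfl | ⟨hGF, hG, -, h⟩)
      · refine ⟨subset_rfl, hF, ?_⟩
        rw [Finset.insert_eq_of_mem ha]
        exact (hF.colClosure_subset subset_rfl).antisymm (subset_colClosure _)
      · exact ⟨hGF, hG, h⟩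
  rw [hset, Finset.sum_insert (by simp [ha])] at h
  linarith

/-- The Möbius function of the lattice of flats alternates in sign with the rank, and a flat
whose Möbius invariant is one contains as many lines as its rank. -/
theorem moebius_sign_and_card_lines (hcol : ∀ j, matCol A j ≠ 0)
    (hrefl : ∀ F, IsFlat A F → μ F F = 1)
    (hsum : ∀ F H, IsFlat A F → IsFlat A H → F ⊂ H →
      ∑ G ∈ H.powerset.filter (fun G => IsFlat A G ∧ F ⊆ G), μ F G = 0)
    (F : Finset (Fin n)) (hF : IsFlat A F) :
    0 < (-1) ^ colRank A F * μ ∅ F ∧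
      ((-1) ^ colRank A F * μ ∅ F = 1 → (F.image (colLine A)).card = colRank A F) := by
  induction F using Finset.strongInduction with
  | H F ih =>
  rcases F.eq_empty_or_nonempty with rfl | ⟨a, ha⟩
  · have h0 : colRank A ∅ = 0 := by
      rw [colRank, Finset.coe_empty, Set.image_empty, Submodule.span_empty, finrank_bot]
    simp [h0, hrefl ∅ (isFlat_empty hcol)]
  set T := F.powerset.filter
    (fun G => IsFlat A G ∧ a ∉ G ∧ colClosure A (insert a G) = F) with hT
  have memT {G} : G ∈ T ↔ G ⊆ F ∧ IsFlat A G ∧ a ∉ G ∧ colClosure A (insert a G) = F := by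
    simp [hT]
  have hlt {G} (hG : G ∈ T) : G ⊂ F :=
    (memT.1 hG).1.ssubset_of_ne fun h => (memT.1 hG).2.2.1 (h ▸ ha)
  have hrk {G} (hG : G ∈ T) : colRank A F = colRank A G + 1 := by
    obtain ⟨-, hGf, haG, h⟩ := memT.1 hG
    rw [← colRank_insert hGf haG, h]
  have hval : (-1) ^ colRank A F * μ ∅ F = ∑ G ∈ T, (-1) ^ colRank A G * μ ∅ G := by
    rw [moebius_eq_neg_sum_hyperplanes hcol hsum hF ha, ← hT, ← Finset.sum_neg_distrib,
      Finset.mul_sum]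
    refine Finset.sum_congr rfl fun G hG => ?_
    rw [hrk hG]
    ring
  have hpos {G} (hG : G ∈ T) : 0 < (-1) ^ colRank A G * μ ∅ G := (ih G (hlt hG) (memT.1 hG).2.1).1
  obtain ⟨G, hGf, -, hGF, haG, hcl⟩ := hF.exists_hyperplane (S := ∅) ha (Finset.empty_subset F)
    (by simp [mem_colClosure, hcol a])
  have hG : G ∈ T := memT.2 ⟨hGF, hGf, haG, hcl⟩
  rw [hval]
  refine ⟨Finset.sum_pos (fun G hG => hpos hG) ⟨G, hG⟩, fun h1 => ?_⟩
  rw [← Finset.add_sum_erase T _ hG] at h1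
  have hnn : ∀ G' ∈ T.erase G, 0 < (-1) ^ colRank A G' * μ ∅ G' := fun G' hG' =>
    hpos (Finset.mem_of_mem_erase hG')
  have huniq {G'} (hG' : G' ∈ T) : G' = G := by
    by_contra hne
    have := Finset.sum_pos hnn ⟨G', Finset.mem_erase.2 ⟨hne, hG'⟩⟩
    have := hpos hG
    omega
  have hGone : (-1) ^ colRank A G * μ ∅ G = 1 := by
    have := Finset.sum_nonneg fun G' hG' => (hnn G' hG').le
    have := hpos hG
    omega
  have himage : F.image (colLine A) = insert (colLine A a) (G.image (colLine A)) := by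
    ext l
    simp only [Finset.mem_image, Finset.mem_insert]
    constructor
    · rintro ⟨b, hb, rfl⟩
      by_cases hab : colLine A a = colLine A b
      · exact Or.inl hab.symm
      · right
        obtain ⟨G', hf, hbG, hF', ha', hc'⟩ := hF.exists_hyperplane (S := {b}) ha
          (Finset.singleton_subset_iff.2 hb) (fun h => hab (colLine_eq_of_mem (hcol a) (by
            simpa [mem_colClosure, colLine] using h)))
        rw [huniq (memT.2 ⟨hF', hf, ha', hc'⟩)] at hbG
        exact ⟨b, Finset.singleton_subset_iff.1 hbG, rfl⟩
    · rintro (rfl | ⟨b, hb, rfl⟩)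
      · exact ⟨a, ha, rfl⟩
      · exact ⟨b, hGF hb, rfl⟩
  rw [himage, Finset.card_insert_of_notMem, (ih G (hlt hG) hGf).2 hGone, hrk hG]
  intro h
  obtain ⟨b, hb, hba⟩ := Finset.mem_image.1 h
  exact haG (hGf.mem_of_colLine_eq hba.symm hb)

theorem natAbs_moebius_of_orderIso (hcol : ∀ j, matCol A j ≠ 0)
    (hrefl : ∀ F, IsFlat A F → μ F F = 1)
    (hsum : ∀ F H, IsFlat A F → IsFlat A H → F ⊂ H →
      ∑ G ∈ H.powerset.filter (fun G => IsFlat A G ∧ F ⊆ G), μ F G = 0)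
    {k : ℕ} (e : {J : Finset (Fin n) // IsFlat A J} ≃o Finset (Fin k)) :
    (μ ∅ Finset.univ).natAbs = 1 := by
  have hbot : (e.symm ∅).1 = ∅ := Finset.subset_empty.1 <|
    show e.symm ∅ ≤ ⟨∅, isFlat_empty hcol⟩ from e.symm_apply_le.2 (Finset.empty_subset _)
  have key (T : Finset (Fin k)) : μ ∅ (e.symm T).1 = (-1) ^ T.card := by
    induction T using Finset.strongInduction with
    | H T ih =>
    rcases T.eq_empty_or_nonempty with rfl | hT
    · rw [hbot, hrefl ∅ (isFlat_empty hcol)]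
      simp
    have hne : ∅ ⊂ (e.symm T).1 := by
      rw [← hbot]
      exact e.symm.strictMono (Finset.empty_ssubset.2 hT)
    have h := hsum ∅ (e.symm T).1 (isFlat_empty hcol) (e.symm T).2 hne
    have h' : ∑ G ∈ (e.symm T).1.powerset.filter (fun G => IsFlat A G ∧ ∅ ⊆ G), μ ∅ G =
        ∑ U ∈ T.powerset, μ ∅ (e.symm U).1 := by
      symm
      refine Finset.sum_nbij (fun U => (e.symm U).1) ?_ ?_ ?_ fun _ _ => rfl
      · intro U hU
        simp only [Finset.mem_filter, Finset.mem_powerset] at hU ⊢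
        exact ⟨e.symm.monotone hU, (e.symm U).2, Finset.empty_subset _⟩
      · intro U _ V _ hUV
        exact e.symm.injective (Subtype.ext hUV)
      · intro G hG
        simp only [Finset.coe_filter, Finset.mem_powerset, Set.mem_ofPred_eq] at hG
        refine ⟨e ⟨G, hG.2.1⟩, ?_, by simp⟩
        simp only [Finset.coe_powerset, Set.mem_preimage, Set.mem_powerset_iff,
          Finset.coe_subset]
        exact e.le_symm_apply.1 hG.1
    have h2 := Finset.sum_powerset_neg_one_pow_card_of_nonempty hT
    rw [h', ← Finset.add_sum_erase _ _ (Finset.mem_powerset_self T)] at h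
    rw [← Finset.add_sum_erase _ _ (Finset.mem_powerset_self T)] at h2
    have h3 : ∑ U ∈ T.powerset.erase T, μ ∅ (e.symm U).1 =
        ∑ U ∈ T.powerset.erase T, (-1) ^ U.card := by
      refine Finset.sum_congr rfl fun U hU => ih U ?_
      rw [Finset.mem_erase, Finset.mem_powerset] at hU
      exact hU.2.ssubset_of_ne hU.1
    linarith
  have htop := key (e ⟨Finset.univ, isFlat_univ⟩)
  rw [e.symm_apply_apply] at htop
  rw [htop, Int.natAbs_pow]
  simp

/-- The lattice of flats of a basic matrix is Boolean. -/
theorem nonempty_orderIso_of_ncard_range_colLine (hrank : A.rank = d)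
    (h : (Set.range (colLine A)).ncard = d) :
    Nonempty ({J : Finset (Fin n) // IsFlat A J} ≃o Finset (Fin d)) := by
  have e : Fin d ≃ Set.range (colLine A) :=
    (finCongr h.symm).trans (Finite.equivFin (Set.range (colLine A))).symm
  choose s hs using fun k => (e k).2
  have hrep (j : Fin n) : ∃ k, colLine A (s k) = colLine A j :=
    ⟨e.symm ⟨_, j, rfl⟩, by rw [hs, e.apply_symm_apply]⟩
  have hspan : Submodule.span ℝ (Set.range (matCol A)) = ⊤ := by
    apply Submodule.eq_top_of_finrank_eq
    rw [Module.finrank_fin_fun, ← Set.image_univ, ← Finset.coe_univ]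
    exact colRank_univ.trans hrank
  have hli : LinearIndependent ℝ fun k => matCol A (s k) := by
    refine linearIndependent_of_top_le_span_of_card_eq_finrank ?_ (by simp)
    rw [← hspan, Submodule.span_le]
    rintro _ ⟨j, rfl⟩
    obtain ⟨k, hk⟩ := hrep j
    have hj : matCol A j ∈ colLine A (s k) := hk ▸ Submodule.mem_span_singleton_self _
    refine Submodule.span_mono ?_ hj
    rintro _ rfl
    exact ⟨k, rfl⟩
  let f : {J : Finset (Fin n) // IsFlat A J} → Finset (Fin d) := fun J =>
    Finset.univ.filter fun k => s k ∈ J.1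
  have hf (J J') : f J ≤ f J' ↔ J ≤ J' := by
    constructor
    · intro hJ j hj
      obtain ⟨k, hk⟩ := hrep j
      have : k ∈ f J' := hJ (by simpa [f] using J.2.mem_of_colLine_eq hk hj)
      exact J'.2.mem_of_colLine_eq hk.symm (by simpa [f] using this)
    · intro hJ k hk
      simp only [f, Finset.mem_filter, Finset.mem_univ, true_and] at hk ⊢
      exact hJ hk
  have hsurj : Function.Surjective f := fun T => by
    refine ⟨⟨colClosure A (T.image s), isFlat_colClosure _⟩, ?_⟩
    ext k
    simp only [f, Finset.mem_filter, Finset.mem_univ, true_and]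
    constructor
    · intro hk
      by_contra hkT
      rw [mem_colClosure, Finset.coe_image, Set.image_image] at hk
      exact hli.notMem_span_image (s := (T : Set (Fin d))) (by simpa using hkT) hk
    · intro hk
      exact subset_colClosure _ (Finset.mem_image_of_mem s hk)
  exact ⟨RelIso.ofSurjective (OrderEmbedding.ofMapLEIff f hf) hsurj⟩

end Flats

/-- For a rank-`d` real `d×n` matrix with no zero columns, the following are equivalent:
(i) the Möbius invariant `|μ(∅, [n])|` equals `1`; (ii) `A` is basic, i.e. its columns span
exactly `d` distinct lines; (iii) the lattice of flats is isomorphic to the Boolean lattice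
of subsets of a `d`-element set. -/
theorem stmt_7 {d n : ℕ} (A : Matrix (Fin d) (Fin n) ℝ)
    (hrank : A.rank = d) (hcol : ∀ j, matCol A j ≠ 0)
    (μ : Finset (Fin n) → Finset (Fin n) → ℤ)
    (hrefl : ∀ F, IsFlat A F → μ F F = 1)
    (hsum : ∀ F H, IsFlat A F → IsFlat A H → F ⊂ H →
      ∑ G ∈ H.powerset.filter (fun G => IsFlat A G ∧ F ⊆ G), μ F G = 0) :
    ((μ ∅ Finset.univ).natAbs = 1 ↔
      (Set.range fun j : Fin n => Submodule.span ℝ {matCol A j}).ncard = d) ∧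
    ((Set.range fun j : Fin n => Submodule.span ℝ {matCol A j}).ncard = d ↔
      Nonempty ({J : Finset (Fin n) // IsFlat A J} ≃o Finset (Fin d))) := by
  have h12 : (μ ∅ Finset.univ).natAbs = 1 →
      (Set.range fun j : Fin n => Submodule.span ℝ {matCol A j}).ncard = d := by
    intro h
    obtain ⟨hpos, hcard⟩ := moebius_sign_and_card_lines hcol hrefl hsum Finset.univ isFlat_univ
    have habs : ((-1) ^ colRank A Finset.univ * μ ∅ Finset.univ).natAbs = 1 := by
      rw [Int.natAbs_mul, Int.natAbs_pow, h]
      simp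
    have h1 := hcard (by omega)
    rw [colRank_univ, hrank, ← Set.ncard_coe_finset, Finset.coe_image, Finset.coe_univ,
      Set.image_univ] at h1
    exact h1
  have h23 : (Set.range fun j : Fin n => Submodule.span ℝ {matCol A j}).ncard = d →
      Nonempty ({J : Finset (Fin n) // IsFlat A J} ≃o Finset (Fin d)) :=
    nonempty_orderIso_of_ncard_range_colLine hrank
  have h31 : Nonempty ({J : Finset (Fin n) // IsFlat A J} ≃o Finset (Fin d)) →
      (μ ∅ Finset.univ).natAbs = 1 := fun ⟨e⟩ => natAbs_moebius_of_orderIso hcol hrefl hsum e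
  exact ⟨⟨h12, fun h => h31 (h23 h)⟩, ⟨h23, fun h => h12 (h31 h)⟩⟩
end

section
/- Let A be a real d×n matrix of rank d with no zero columns, L ⊆ ℂ^n the ℂ-span of the rows of A, and L^{−1} ⊆ ℂ^n its reciprocal plane. Let S be any set of circuit vectors of A. Then the common zero set { x ∈ ℂ^n : h_v(x) = 0 for all v ∈ S } equals L^{−1} if and only if S exposes every non-flat, i.e., for every subset J ⊆ {1,…,n} that is not a flat of A there exists v ∈ S such that exactly one element of supp(v) lies outside J. -/
open scoped Classical

/-- A circuit vector of `A`: a nonzero kernel vector with inclusion-minimal support. -/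
def IsCircuit {d n : ℕ} (A : Matrix (Fin d) (Fin n) ℝ) (v : Fin n → ℝ) : Prop :=
  v ≠ 0 ∧ A.mulVec v = 0 ∧
    ∀ w : Fin n → ℝ, w ≠ 0 → A.mulVec w = 0 →
      {i | w i ≠ 0} ⊆ {i | v i ≠ 0} → {i | w i ≠ 0} = {i | v i ≠ 0}

/-- The support of `v` as a finset. -/
noncomputable def suppF {n : ℕ} (v : Fin n → ℝ) : Finset (Fin n) :=
  Finset.univ.filter (fun i => v i ≠ 0)

/-- The circuit polynomial `h_v = Σ_{i∈supp v} vᵢ ∏_{j∈supp v, j≠i} xⱼ`. -/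
noncomputable def circuitPoly {n : ℕ} (v : Fin n → ℝ) : MvPolynomial (Fin n) ℂ :=
  ∑ i ∈ suppF v, MvPolynomial.C (v i : ℂ) * ∏ j ∈ suppF v \ {i}, MvPolynomial.X j

/-- The reciprocal plane `L⁻¹`: the zero locus of the vanishing ideal of
`{u⁻¹ : u ∈ L, all uᵢ ≠ 0}`. -/
def reciprocalPlane {ι : Type*} (L : Submodule ℂ (ι → ℂ)) : Set (ι → ℂ) :=
  {x | ∀ f : MvPolynomial ι ℂ,
    (∀ u : ι → ℂ, u ∈ L → (∀ i, u i ≠ 0) → MvPolynomial.eval (fun i => (u i)⁻¹) f = 0) →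
    MvPolynomial.eval x f = 0}

/-- The complex row space of a real matrix. -/
noncomputable def rowSpaceC {d n : ℕ} (A : Matrix (Fin d) (Fin n) ℝ) :
    Submodule ℂ (Fin n → ℂ) :=
  Submodule.span ℂ (Set.range fun i : Fin d => fun j : Fin n => (A i j : ℂ))

section Helpers

variable {d n : ℕ} {A : Matrix (Fin d) (Fin n) ℝ}

lemma mem_suppF {v : Fin n → ℝ} {i : Fin n} : i ∈ suppF v ↔ v i ≠ 0 := by
  simp [suppF]

lemma mem_rowSpaceC_iff {u : Fin n → ℂ} :
    u ∈ rowSpaceC A ↔ ∃ φ : (Fin d → ℝ) →ₗ[ℝ] ℂ, ∀ j, u j = φ (matCol A j) := by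
  rw [rowSpaceC, Submodule.mem_span_range_iff_exists_fun]
  constructor
  · rintro ⟨c, rfl⟩
    refine ⟨∑ i, (LinearMap.proj i : (Fin d → ℝ) →ₗ[ℝ] ℝ).smulRight (c i), fun j => ?_⟩
    simp [matCol, LinearMap.sum_apply, mul_comm]
  · rintro ⟨φ, hφ⟩
    refine ⟨fun i => φ (Pi.single i 1), ?_⟩
    ext j
    rw [hφ, LinearMap.pi_apply_eq_sum_univ φ (matCol A j)]
    simp only [Finset.sum_apply, Pi.smul_apply, smul_eq_mul, matCol, Complex.real_smul]
    refine Finset.sum_congr rfl fun i _ => ?_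
    rw [mul_comm]
    congr 2
    ext k
    simp [Pi.single_apply, eq_comm]

lemma mulVec_eq_sum_smul_matCol (A : Matrix (Fin d) (Fin n) ℝ) (v : Fin n → ℝ) :
    A.mulVec v = ∑ j, v j • matCol A j := by
  ext i
  simp [Matrix.mulVec, dotProduct, matCol, mul_comm]

/-- A real kernel vector of `A` is orthogonal to the complex row space of `A`. -/
lemma sum_mul_eq_zero_of_mem_rowSpaceC {v : Fin n → ℝ} (hv : A.mulVec v = 0)
    {u : Fin n → ℂ} (hu : u ∈ rowSpaceC A) : ∑ j, (v j : ℂ) * u j = 0 := by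
  obtain ⟨φ, hφ⟩ := mem_rowSpaceC_iff.1 hu
  have := congrArg φ ((mulVec_eq_sum_smul_matCol A v).symm.trans hv)
  simpa [map_sum, hφ] using this

lemma eval_circuitPoly (x : Fin n → ℂ) (v : Fin n → ℝ) :
    MvPolynomial.eval x (circuitPoly v) =
      ∑ i ∈ suppF v, (v i : ℂ) * ∏ j ∈ suppF v \ {i}, x j := by
  simp [circuitPoly, map_sum, map_prod]

lemma eval_circuitPoly_of_forall_ne_zero {x : Fin n → ℂ} {v : Fin n → ℝ}
    (hx : ∀ i ∈ suppF v, x i ≠ 0) :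
    MvPolynomial.eval x (circuitPoly v) =
      (∏ j ∈ suppF v, x j) * ∑ i, (v i : ℂ) * (x i)⁻¹ := by
  have hsum : ∑ i, (v i : ℂ) * (x i)⁻¹ = ∑ i ∈ suppF v, (v i : ℂ) * (x i)⁻¹ := by
    refine (Finset.sum_subset (Finset.subset_univ _) fun i _ hi => ?_).symm
    rw [mem_suppF, not_not] at hi
    simp [hi]
  rw [eval_circuitPoly, hsum, Finset.mul_sum]
  refine Finset.sum_congr rfl fun i hi => ?_
  have hne := hx i hi
  rw [← Finset.prod_sdiff (Finset.singleton_subset_iff.2 hi), Finset.prod_singleton]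
  field_simp

lemma eval_circuitPoly_ne_zero {x : Fin n → ℂ} {v : Fin n → ℝ} {k : Fin n}
    (hk : k ∈ suppF v) (hxk : x k = 0) (hx : ∀ i ∈ suppF v, i ≠ k → x i ≠ 0) :
    MvPolynomial.eval x (circuitPoly v) ≠ 0 := by
  rw [eval_circuitPoly, Finset.sum_eq_single_of_mem k hk]
  · refine mul_ne_zero (by exact_mod_cast mem_suppF.1 hk) (Finset.prod_ne_zero_iff.2 ?_)
    intro i hi
    rw [Finset.mem_sdiff, Finset.mem_singleton] at hi
    exact hx i hi.1 hi.2
  · intro i _ hik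
    rw [Finset.prod_eq_zero (i := k) _ hxk, mul_zero]
    simp [hk, Ne.symm hik]

lemma eval_circuitPoly_eq_zero_of_one_lt_card {x : Fin n → ℂ} {v : Fin n → ℝ}
    {J : Finset (Fin n)} (hx : ∀ i, i ∉ J → x i = 0) (h : 1 < (suppF v \ J).card) :
    MvPolynomial.eval x (circuitPoly v) = 0 := by
  rw [eval_circuitPoly]
  refine Finset.sum_eq_zero fun i _ => ?_
  obtain ⟨k, hk, hki⟩ := Finset.exists_mem_ne h i
  rw [Finset.mem_sdiff] at hk
  rw [Finset.prod_eq_zero (i := k) _ (hx k hk.2), mul_zero]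
  simp [hk.1, hki]

lemma eval_circuitPoly_eq_zero_of_mem_reciprocalPlane {v : Fin n → ℝ} (hv : A.mulVec v = 0)
    {x : Fin n → ℂ} (hx : x ∈ reciprocalPlane (rowSpaceC A)) :
    MvPolynomial.eval x (circuitPoly v) = 0 := by
  refine hx _ fun u hu hu0 => ?_
  rw [eval_circuitPoly_of_forall_ne_zero fun i _ => inv_ne_zero (hu0 i)]
  simp [sum_mul_eq_zero_of_mem_rowSpaceC hv hu]

/-- Some real functional on column space vanishes on exactly the columns lying in a given
subspace. -/
lemma exists_dual_matCol_eq_zero_iff (A : Matrix (Fin d) (Fin n) ℝ)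
    (W : Submodule ℝ (Fin d → ℝ)) :
    ∃ ψ : (Fin d → ℝ) →ₗ[ℝ] ℝ, ∀ j, ψ (matCol A j) = 0 ↔ matCol A j ∈ W := by
  obtain ⟨ψ, hψW, hψ⟩ := Module.Dual.exists_forall_mem_ne_zero_of_forall_exists
    W.dualAnnihilator
    (fun j : {j // matCol A j ∉ W} => Module.Dual.eval ℝ (Fin d → ℝ) (matCol A j))
    (fun j => by
      obtain ⟨f, hf, hW⟩ := Submodule.exists_le_ker_of_notMem j.2
      exact ⟨f, (Submodule.mem_dualAnnihilator f).2 fun w hw => hW hw, hf⟩)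
  refine ⟨ψ, fun j => ⟨fun h => ?_, fun h => (Submodule.mem_dualAnnihilator ψ).1 hψW _ h⟩⟩
  by_contra hj
  exact hψ ⟨j, hj⟩ h

/-- A point supported on a flat is in the reciprocal plane as soon as its inverse agrees on that
flat with a vector of the row space. -/
lemma mem_reciprocalPlane_of_isFlat {F : Finset (Fin n)} (hF : IsFlat A F) {x u : Fin n → ℂ}
    (hx : ∀ i, x i ≠ 0 ↔ i ∈ F) (hu : u ∈ rowSpaceC A) (hux : ∀ i ∈ F, u i = (x i)⁻¹) :
    x ∈ reciprocalPlane (rowSpaceC A) := by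
  obtain ⟨ψ, hψ⟩ := exists_dual_matCol_eq_zero_iff A (Submodule.span ℝ (matCol A '' ↑F))
  set w : Fin n → ℂ := fun j => (ψ (matCol A j) : ℂ) with hw
  have hwL : w ∈ rowSpaceC A :=
    mem_rowSpaceC_iff.2 ⟨ψ.smulRight (1 : ℂ), fun j => by simp [hw]⟩
  have hw0 : ∀ i, w i = 0 ↔ i ∈ F := fun i => by
    rw [hF i, ← hψ i]
    simp [hw]
  have hlim : ∀ i, Filter.Tendsto (fun s : ℂ => (u i + s⁻¹ * w i)⁻¹)
      (nhdsWithin 0 {0}ᶜ) (nhds (x i)) := by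
    intro i
    by_cases hi : i ∈ F
    · simp [(hw0 i).2 hi, hux i hi]
    · have hwi : w i ≠ 0 := fun h => hi ((hw0 i).1 h)
      have hxi : x i = 0 := by
        by_contra h
        exact hi ((hx i).1 h)
      have hc : ContinuousAt (fun s : ℂ => s * (s * u i + w i)⁻¹) 0 :=
        continuousAt_id.mul
          (((continuousAt_id.mul continuousAt_const).add continuousAt_const).inv₀ (by simpa [hw] using hwi))
      have ht := hc.tendsto.mono_left (nhdsWithin_le_nhds (s := {0}ᶜ))
      rw [hxi]
      simp only [zero_mul] at ht
      refine ht.congr' ?_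
      filter_upwards [self_mem_nhdsWithin] with s hs
      have hs' : s ≠ 0 := hs
      have : u i + s⁻¹ * w i = s⁻¹ * (s * u i + w i) := by field_simp
      rw [this, mul_inv, inv_inv]
  have hne : ∀ i, ∀ᶠ s : ℂ in nhdsWithin 0 {0}ᶜ, u i + s⁻¹ * w i ≠ 0 := by
    intro i
    by_cases hi : i ∈ F
    · simp [(hw0 i).2 hi, hux i hi, (hx i).2 hi]
    · have hwi : w i ≠ 0 := fun h => hi ((hw0 i).1 h)
      have hc : ContinuousAt (fun s : ℂ => s * u i + w i) 0 := by fun_prop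
      have := (hc.eventually_ne (by simpa using hwi : (0 : ℂ) * u i + w i ≠ 0)).filter_mono
        (nhdsWithin_le_nhds (s := {0}ᶜ))
      filter_upwards [self_mem_nhdsWithin, this] with s hs hsu
      have hs' : s ≠ 0 := hs
      have : u i + s⁻¹ * w i = s⁻¹ * (s * u i + w i) := by field_simp
      rw [this]
      exact mul_ne_zero (inv_ne_zero hs') hsu
  intro f hf
  have ht : Filter.Tendsto
      (fun s : ℂ => MvPolynomial.eval (fun i => (u i + s⁻¹ * w i)⁻¹) f)
      (nhdsWithin 0 {0}ᶜ) (nhds (MvPolynomial.eval x f)) :=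
    (MvPolynomial.continuous_eval f).continuousAt.tendsto.comp (tendsto_pi_nhds.2 hlim)
  refine tendsto_nhds_unique ht (tendsto_const_nhds.congr' ?_)
  filter_upwards [Filter.eventually_all.2 hne] with s hs
  exact (hf (fun i => u i + s⁻¹ * w i)
    ((rowSpaceC A).add_mem hu ((rowSpaceC A).smul_mem s⁻¹ hwL)) hs).symm

/-- Values prescribed on a suitable spanning subfamily of the columns indexed by `F` are attained
by a functional. -/
lemma exists_spanning_subset_forall_exists_linearMap (A : Matrix (Fin d) (Fin n) ℝ)
    (F : Finset (Fin n)) :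
    ∃ B ⊆ F, (∀ i ∈ F, matCol A i ∈ Submodule.span ℝ (matCol A '' ↑B)) ∧
      ∀ y : Fin n → ℂ, ∃ φ : (Fin d → ℝ) →ₗ[ℝ] ℂ, ∀ i ∈ B, φ (matCol A i) = y i := by
  obtain ⟨κ, a, ha, hspan, hli⟩ :=
    exists_linearIndependent' ℝ (fun i : {i // i ∈ F} => matCol A i)
  have himage : matCol A '' ((Set.range fun k => (a k : Fin n)).toFinset : Finset (Fin n)) =
      Set.range ((fun i : {i // i ∈ F} => matCol A i) ∘ a) := by
    rw [Set.coe_toFinset, ← Set.range_comp]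
    rfl
  refine ⟨(Set.range fun k => (a k : Fin n)).toFinset, ?_, fun i hi => ?_, fun y => ?_⟩
  · intro i hi
    obtain ⟨k, rfl⟩ := Set.mem_toFinset.1 hi
    exact (a k).2
  · rw [himage, hspan]
    exact Submodule.subset_span ⟨⟨i, hi⟩, rfl⟩
  · obtain ⟨φ, hφ⟩ := LinearMap.exists_extend
      ((Module.Basis.span hli).constr ℝ fun k => y (a k))
    refine ⟨φ, fun i hi => ?_⟩
    obtain ⟨k, rfl⟩ := Set.mem_toFinset.1 hi
    have := LinearMap.congr_fun hφ (Module.Basis.span hli k)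
    rw [Module.Basis.constr_basis] at this
    simpa [Module.Basis.span_apply] using this

lemma exists_span_notMem_of_not_isFlat {J : Finset (Fin n)} (hJ : ¬ IsFlat A J) :
    ∃ k ∉ J, matCol A k ∈ Submodule.span ℝ (matCol A '' ↑J) := by
  by_contra! h
  refine hJ fun i => ⟨fun hi => Submodule.subset_span ⟨i, hi, rfl⟩, fun hi => ?_⟩
  by_contra hiJ
  exact h i hiJ hi

/-- A column outside `J` lying in the span of those in `J` yields a kernel vector whose support
meets the complement of `J` in that column only. -/
lemma exists_mulVec_eq_zero_of_mem_span {J : Finset (Fin n)} {k : Fin n} (hk : k ∉ J)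
    (h : matCol A k ∈ Submodule.span ℝ (matCol A '' ↑J)) :
    ∃ c : Fin n → ℝ, A.mulVec c = 0 ∧ c k ≠ 0 ∧ ∀ i, c i ≠ 0 → i ≠ k → i ∈ J := by
  rw [Submodule.mem_span_image_finset_iff_exists_fun] at h
  obtain ⟨c, hc⟩ := h
  have hsum : ∑ i, (if h : i ∈ J then c ⟨i, h⟩ else 0) • matCol A i = matCol A k := by
    rw [← hc, ← Finset.sum_subset (Finset.subset_univ J) fun i _ hi => by simp [hi],
      ← Finset.sum_coe_sort]
    simp
  refine ⟨fun i => (if h : i ∈ J then c ⟨i, h⟩ else 0) - if i = k then 1 else 0, ?_, by simp [hk], ?_⟩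
  · rw [mulVec_eq_sum_smul_matCol]
    simp only [sub_smul, Finset.sum_sub_distrib, hsum]
    simp
  · intro i hi hik
    by_contra hiJ
    simp [hik, hiJ] at hi

lemma isFlat_support_of_mem_reciprocalPlane {x : Fin n → ℂ}
    (hx : x ∈ reciprocalPlane (rowSpaceC A)) {J : Finset (Fin n)} (hJ : ∀ i, x i ≠ 0 ↔ i ∈ J) :
    IsFlat A J := by
  by_contra hflat
  obtain ⟨k, hkJ, hk⟩ := exists_span_notMem_of_not_isFlat hflat
  obtain ⟨c, hc, hck, hcJ⟩ := exists_mulVec_eq_zero_of_mem_span hkJ hk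
  refine eval_circuitPoly_ne_zero (mem_suppF.2 hck) ?_ ?_
    (eval_circuitPoly_eq_zero_of_mem_reciprocalPlane hc hx)
  · by_contra h
    exact hkJ ((hJ k).1 h)
  · exact fun i hi hik => (hJ i).2 (hcJ i (mem_suppF.1 hi) hik)

lemma mem_reciprocalPlane_of_exposes {S : Set (Fin n → ℝ)} (hS : ∀ v ∈ S, A.mulVec v = 0)
    (hexp : ∀ J : Finset (Fin n), ¬ IsFlat A J → ∃ v ∈ S, (suppF v \ J).card = 1)
    {x : Fin n → ℂ} (hx : ∀ v ∈ S, MvPolynomial.eval x (circuitPoly v) = 0) :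
    x ∈ reciprocalPlane (rowSpaceC A) := by
  have hexp' : ∀ J : Finset (Fin n), ¬ IsFlat A J →
      ∃ v ∈ S, ∃ k ∈ suppF v, k ∉ J ∧ ∀ i ∈ suppF v, i ≠ k → i ∈ J := by
    intro J hJ
    obtain ⟨v, hv, hcard⟩ := hexp J hJ
    obtain ⟨k, hk⟩ := Finset.card_eq_one.1 hcard
    have hkm : k ∈ suppF v \ J := by simp [hk]
    rw [Finset.mem_sdiff] at hkm
    refine ⟨v, hv, k, hkm.1, hkm.2, fun i hi hik => ?_⟩
    by_contra hiJ
    exact hik (Finset.mem_singleton.1 (hk ▸ Finset.mem_sdiff.2 ⟨hi, hiJ⟩))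
  set F : Finset (Fin n) := Finset.univ.filter fun i => x i ≠ 0 with hFdef
  have hxF : ∀ i, x i ≠ 0 ↔ i ∈ F := fun i => by simp [hFdef]
  have hF : IsFlat A F := by
    by_contra hF
    obtain ⟨v, hv, k, hk, hkF, hvF⟩ := hexp' F hF
    refine eval_circuitPoly_ne_zero hk ?_ (fun i hi hik => (hxF i).2 (hvF i hi hik)) (hx v hv)
    by_contra h
    exact hkF ((hxF k).1 h)
  obtain ⟨B, hBF, hspan, hB⟩ := exists_spanning_subset_forall_exists_linearMap A F
  obtain ⟨φ, hφ⟩ := hB fun i => (x i)⁻¹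
  have hu : (fun j => φ (matCol A j)) ∈ rowSpaceC A := mem_rowSpaceC_iff.2 ⟨φ, fun _ => rfl⟩
  refine mem_reciprocalPlane_of_isFlat hF hxF hu ?_
  set J : Finset (Fin n) := F.filter fun i => φ (matCol A i) = (x i)⁻¹ with hJdef
  have hBJ : B ⊆ J := fun i hi => Finset.mem_filter.2 ⟨hBF hi, hφ i hi⟩
  have hFJ : Submodule.span ℝ (matCol A '' ↑F) ≤ Submodule.span ℝ (matCol A '' ↑J) := by
    refine Submodule.span_le.2 ?_
    rintro _ ⟨i, hi, rfl⟩
    exact Submodule.span_mono (Set.image_mono hBJ) (hspan i hi)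
  suffices hJF : IsFlat A J by
    intro i hi
    exact (Finset.mem_filter.1 ((hJF i).2 (hFJ ((hF i).1 hi)))).2
  by_contra hJ
  obtain ⟨v, hv, k, hk, hkJ, hvJ⟩ := hexp' J hJ
  have hkerv := hS v hv
  have hkspan : matCol A k ∈ Submodule.span ℝ (matCol A '' ↑J) := by
    have h0 := (mulVec_eq_sum_smul_matCol A v).symm.trans hkerv
    rw [← Finset.add_sum_erase _ _ (Finset.mem_univ k)] at h0
    rw [← Submodule.smul_mem_iff _ (mem_suppF.1 hk), eq_neg_of_add_eq_zero_left h0]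
    refine Submodule.neg_mem _ (Submodule.sum_mem _ fun i hi => ?_)
    by_cases hvi : v i = 0
    · simp [hvi]
    · exact Submodule.smul_mem _ _ (Submodule.subset_span
        ⟨i, hvJ i (mem_suppF.2 hvi) (Finset.ne_of_mem_erase hi), rfl⟩)
  have hkF : k ∈ F := (hF k).2
    (Submodule.span_mono (Set.image_mono (Finset.filter_subset _ _)) hkspan)
  have hne : ∀ i ∈ suppF v, x i ≠ 0 := fun i hi => by
    by_cases hik : i = k
    · exact (hxF i).2 (hik ▸ hkF)
    · exact (hxF i).2 (Finset.mem_filter.1 (hvJ i hi hik)).1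
  have hx0 := hx v hv
  rw [eval_circuitPoly_of_forall_ne_zero hne] at hx0
  have hsx := (mul_eq_zero.1 hx0).resolve_left (Finset.prod_ne_zero_iff.2 hne)
  have hsu := sum_mul_eq_zero_of_mem_rowSpaceC hkerv hu
  have hdiff : ∑ i, (v i : ℂ) * (φ (matCol A i) - (x i)⁻¹) = 0 := by
    simp only [mul_sub, Finset.sum_sub_distrib, hsu, hsx, sub_zero]
  rw [Finset.sum_eq_single k] at hdiff
  · have hvk : (v k : ℂ) ≠ 0 := by exact_mod_cast mem_suppF.1 hk
    exact hkJ (Finset.mem_filter.2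
      ⟨hkF, sub_eq_zero.1 ((mul_eq_zero.1 hdiff).resolve_left hvk)⟩)
  · intro i _ hik
    by_cases hvi : v i = 0
    · simp [hvi]
    · simp [(Finset.mem_filter.1 (hvJ i (mem_suppF.2 hvi) hik)).2]
  · simp

lemma exists_forall_eval_circuitPoly_eq_zero (hcol : ∀ j, matCol A j ≠ 0)
    {S : Set (Fin n → ℝ)} (hS : ∀ v ∈ S, A.mulVec v = 0) {J : Finset (Fin n)}
    (hJ : ∀ v ∈ S, (suppF v \ J).card ≠ 1) :
    ∃ x : Fin n → ℂ, (∀ i, x i ≠ 0 ↔ i ∈ J) ∧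
      ∀ v ∈ S, MvPolynomial.eval x (circuitPoly v) = 0 := by
  obtain ⟨ψ, hψ⟩ := exists_dual_matCol_eq_zero_iff A ⊥
  have hψ0 : ∀ i, ψ (matCol A i) ≠ 0 := fun i h =>
    hcol i ((Submodule.mem_bot ℝ).1 ((hψ i).1 h))
  have hu : (fun j => (ψ (matCol A j) : ℂ)) ∈ rowSpaceC A :=
    mem_rowSpaceC_iff.2 ⟨ψ.smulRight (1 : ℂ), fun j => by simp⟩
  have hxJ : ∀ i, (if i ∈ J then (ψ (matCol A i) : ℂ)⁻¹ else 0) ≠ 0 ↔ i ∈ J := fun i => by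
    by_cases hi : i ∈ J <;> simp [hi, hψ0 i]
  refine ⟨fun i => if i ∈ J then (ψ (matCol A i) : ℂ)⁻¹ else 0, hxJ, fun v hv => ?_⟩
  rcases Nat.lt_or_gt_of_ne (hJ v hv) with h | h
  · have hsub : suppF v ⊆ J := by
      rw [← Finset.sdiff_eq_empty_iff_subset, ← Finset.card_eq_zero]
      omega
    rw [eval_circuitPoly_of_forall_ne_zero fun i hi => (hxJ i).2 (hsub hi)]
    refine mul_eq_zero_of_right _ ?_
    rw [← sum_mul_eq_zero_of_mem_rowSpaceC (hS v hv) hu]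
    refine Finset.sum_congr rfl fun i _ => ?_
    by_cases hvi : v i = 0
    · simp [hvi]
    · simp [hsub (mem_suppF.2 hvi)]
  · exact eval_circuitPoly_eq_zero_of_one_lt_card (fun i hi => by simp [hi]) h

end Helpers

/-- A set `S` of circuit vectors of `A` cuts out `L⁻¹` set-theoretically iff `S` exposes
every non-flat. -/
theorem stmt_10 {d n : ℕ} (A : Matrix (Fin d) (Fin n) ℝ)
    (hrank : A.rank = d) (hcol : ∀ j, matCol A j ≠ 0)
    (S : Set (Fin n → ℝ)) (hS : ∀ v ∈ S, IsCircuit A v) :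
    {x : Fin n → ℂ | ∀ v ∈ S, MvPolynomial.eval x (circuitPoly v) = 0} =
        reciprocalPlane (rowSpaceC A) ↔
      ∀ J : Finset (Fin n), ¬ IsFlat A J → ∃ v ∈ S, (suppF v \ J).card = 1 := by
  have hker : ∀ v ∈ S, A.mulVec v = 0 := fun v hv => (hS v hv).2.1
  constructor
  · intro hV J hJ
    by_contra! hexp
    obtain ⟨x, hxJ, hx⟩ := exists_forall_eval_circuitPoly_eq_zero hcol hker hexp
    have hxV : x ∈ {x : Fin n → ℂ | ∀ v ∈ S, MvPolynomial.eval x (circuitPoly v) = 0} := hx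
    rw [hV] at hxV
    exact hJ (isFlat_support_of_mem_reciprocalPlane hxV hxJ)
  · intro hexp
    ext x
    exact ⟨fun hx => mem_reciprocalPlane_of_exposes hker hexp hx,
      fun hx v hv => eval_circuitPoly_eq_zero_of_mem_reciprocalPlane (hker v hv) hx⟩
end

section
/- Let A be a real d×n matrix of rank d with no zero columns, and let S be a set of circuit vectors of A that exposes every non-flat (for every non-flat J ⊆ {1,…,n} there exists v ∈ S with exactly one element of supp(v) outside J). Then for every flat J of A, the kernel of the column-submatrix A_J is spanned by the restrictions to the coordinates in J of the vectors { v ∈ S : supp(v) ⊆ J }. -/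
open scoped Classical

/-- If a kernel vector is supported in `insert i K` and does not vanish at `i`, then the `i`-th
column lies in the span of the columns indexed by `K`. -/
theorem matCol_mem_span_of_mulVec_eq_zero {d n : ℕ} {A : Matrix (Fin d) (Fin n) ℝ}
    {w : Fin n → ℝ} (hw : A.mulVec w = 0) {K : Finset (Fin n)} {i : Fin n}
    (hK : ∀ j, w j ≠ 0 → j = i ∨ j ∈ K) (hi : w i ≠ 0) :
    matCol A i ∈ Submodule.span ℝ (matCol A '' ↑K) := by
  have hsum : ∑ j, w j • matCol A j = 0 := by
    rw [← hw]
    ext k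
    simp [Matrix.mulVec, dotProduct, matCol, mul_comm]
  rw [← Finset.add_sum_erase _ _ (Finset.mem_univ i)] at hsum
  rw [← Submodule.smul_mem_iff _ hi, eq_neg_of_add_eq_zero_left hsum]
  refine Submodule.neg_mem _ (Submodule.sum_mem _ fun j hj => ?_)
  by_cases hj0 : w j = 0
  · simp [hj0]
  · have hjK : j ∈ K := (hK j hj0).resolve_left (Finset.ne_of_mem_erase hj)
    exact Submodule.smul_mem _ _ (Submodule.subset_span ⟨j, hjK, rfl⟩)

/-- Kernel vectors supported in a flat `J` lie in the span of the vectors of `S` supported in `J`,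
provided `S` consists of kernel vectors and exposes every non-flat. -/
theorem IsFlat.mem_span_of_mulVec_eq_zero {d n : ℕ} {A : Matrix (Fin d) (Fin n) ℝ}
    {S : Set (Fin n → ℝ)} (hS : ∀ v ∈ S, A.mulVec v = 0)
    (hexp : ∀ J : Finset (Fin n), ¬ IsFlat A J → ∃ v ∈ S, (suppF v \ J).card = 1)
    {J : Finset (Fin n)} (hJ : IsFlat A J) {w : Fin n → ℝ} (hw : A.mulVec w = 0)
    (hwJ : ∀ i, w i ≠ 0 → i ∈ J) :
    w ∈ Submodule.span ℝ {v ∈ S | ∀ i : Fin n, v i ≠ 0 → i ∈ J} := by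
  set T := Submodule.span ℝ {v ∈ S | ∀ i : Fin n, v i ≠ 0 → i ∈ J} with hT
  let P : Finset (Fin n) → Prop := fun K =>
    K ⊆ J ∧ ∀ w : Fin n → ℝ, A.mulVec w = 0 → (∀ i, w i ≠ 0 → i ∈ K) → w ∈ T
  have hempty : P ∅ := by
    refine ⟨Finset.empty_subset _, fun w _ h => ?_⟩
    have hw0 : w = 0 := funext fun i => by
      by_contra hi
      exact absurd (h i hi) (Finset.notMem_empty i)
    exact hw0 ▸ T.zero_mem
  have hstep : ∀ K, P K → K ≠ J → ∃ i ∉ K, P (insert i K) := by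
    rintro K ⟨hKJ, hK⟩ hne
    by_cases hflat : IsFlat A K
    · obtain ⟨i, hiJ, hiK⟩ := Finset.exists_of_ssubset (hKJ.ssubset_of_ne hne)
      refine ⟨i, hiK, Finset.insert_subset hiJ hKJ, fun w hw h => hK w hw fun j hj => ?_⟩
      have hwi : w i = 0 := by
        by_contra hi
        exact hiK ((hflat i).2 (matCol_mem_span_of_mulVec_eq_zero hw
          (fun j hj => Finset.mem_insert.1 (h j hj)) hi))
      refine (Finset.mem_insert.1 (h j hj)).resolve_left ?_
      rintro rfl
      exact hj hwi
    · obtain ⟨v, hvS, hcard⟩ := hexp K hflat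
      obtain ⟨i, hi⟩ := Finset.card_eq_one.1 hcard
      have hmem : ∀ j, v j ≠ 0 ∧ j ∉ K ↔ j = i := fun j => by
        simpa [suppF] using Finset.ext_iff.1 hi j
      obtain ⟨hvi, hiK⟩ := (hmem i).2 rfl
      have hvK : ∀ j, v j ≠ 0 → j = i ∨ j ∈ K := fun j hj => by
        by_cases hjK : j ∈ K
        · exact Or.inr hjK
        · exact Or.inl ((hmem j).1 ⟨hj, hjK⟩)
      have hiJ : i ∈ J := (hJ i).2 (Submodule.span_mono (Set.image_mono hKJ)
        (matCol_mem_span_of_mulVec_eq_zero (hS v hvS) hvK hvi))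
      have hvT : v ∈ T := Submodule.subset_span ⟨hvS, fun j hj =>
        (hvK j hj).elim (fun h => h ▸ hiJ) fun h => hKJ h⟩
      refine ⟨i, hiK, Finset.insert_subset hiJ hKJ, fun w hw h => ?_⟩
      have hsub : w - (w i / v i) • v ∈ T := by
        refine hK _ ?_ fun j hj => ?_
        · rw [Matrix.mulVec_sub, Matrix.mulVec_smul, hw, hS v hvS, smul_zero, sub_zero]
        · by_contra hjK
          by_cases hji : j = i
          · subst hji
            exact hj (by simp [hvi])
          · have hwj : w j = 0 := by
              by_contra h0
              exact (Finset.mem_insert.1 (h j h0)).elim hji hjK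
            have hvj : v j = 0 := by
              by_contra h0
              exact (hvK j h0).elim hji hjK
            exact hj (by simp [hwj, hvj])
      simpa using T.add_mem hsub (T.smul_mem (w i / v i) hvT)
  obtain ⟨K, hKP, hmax⟩ := Finset.exists_max_image (Finset.univ.filter P) Finset.card
    ⟨∅, by simpa using hempty⟩
  have hPK : P K := by simpa using hKP
  have hKJ : K = J := by
    by_contra hne
    obtain ⟨i, hiK, hi⟩ := hstep K hPK hne
    have hle := hmax _ (Finset.mem_filter.2 ⟨Finset.mem_univ _, hi⟩)
    rw [Finset.card_insert_of_notMem hiK] at hle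
    omega
  exact hPK.2 w hw (hKJ ▸ hwJ)

/-- Restricting a vector supported in `J` to `J` does not change its product with `A`. -/
theorem submatrix_mulVec_restrict {d n : ℕ} (A : Matrix (Fin d) (Fin n) ℝ)
    {J : Finset (Fin n)} {v : Fin n → ℝ} (hv : ∀ i, v i ≠ 0 → i ∈ J) :
    (A.submatrix id ((↑) : ↥J → Fin n)).mulVec (fun j => v j) = A.mulVec v := by
  ext k
  simp only [Matrix.mulVec, dotProduct, Matrix.submatrix_apply, id]
  rw [Finset.sum_coe_sort J fun j => A k j * v j]
  refine Finset.sum_subset (Finset.subset_univ J) fun j _ hj => ?_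
  rw [not_imp_comm.1 (hv j) hj, mul_zero]

/-- If a set `S` of circuit vectors of `A` exposes every non-flat, then for every flat `J`,
the kernel of the column submatrix `A_J` is spanned by the restrictions to `J` of the
vectors of `S` supported in `J`. -/
theorem stmt_11 {d n : ℕ} (A : Matrix (Fin d) (Fin n) ℝ)
    (hrank : A.rank = d) (hcol : ∀ j, matCol A j ≠ 0)
    (S : Set (Fin n → ℝ)) (hS : ∀ v ∈ S, IsCircuit A v)
    (hexp : ∀ J : Finset (Fin n), ¬ IsFlat A J → ∃ v ∈ S, (suppF v \ J).card = 1)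
    (J : Finset (Fin n)) (hJ : IsFlat A J) :
    LinearMap.ker (A.submatrix id ((↑) : ↥J → Fin n)).mulVecLin =
      Submodule.span ℝ
        ((fun v : Fin n → ℝ => fun j : ↥J => v j) ''
          {v ∈ S | ∀ i : Fin n, v i ≠ 0 → i ∈ J}) := by
  apply le_antisymm
  · intro x hx
    let w : Fin n → ℝ := fun i => if h : i ∈ J then x ⟨i, h⟩ else 0
    have hwJ : ∀ i, w i ≠ 0 → i ∈ J := fun i hi => by
      by_contra h
      exact hi (dif_neg h)
    have hwx : (fun j : ↥J => w j) = x := funext fun j => dif_pos j.2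
    have hw : A.mulVec w = 0 := by
      rw [← submatrix_mulVec_restrict A hwJ, hwx]
      exact hx
    have hmem := Submodule.mem_map_of_mem (f := LinearMap.funLeft ℝ ℝ ((↑) : ↥J → Fin n))
      (hJ.mem_span_of_mulVec_eq_zero (fun v hv => (hS v hv).2.1) hexp hw hwJ)
    rw [Submodule.map_span] at hmem
    rw [← hwx]
    exact hmem
  · rw [Submodule.span_le]
    rintro _ ⟨v, ⟨hvS, hvJ⟩, rfl⟩
    exact (submatrix_mulVec_restrict A hvJ).trans (hS v hvS).2.1
end
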